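/- Let Y ≥ X ≥ 1 and ψ: ℤ ∩ [X,Y] → [0,∞) be such that 1 ≤ ∑_{X ≤ n ≤ Y} ψ(n)φ(n)/n ≤ 2. For each t ≥ 1, let ℰ_t := {(v,w) ∈ (ℤ ∩ [X,Y])² : D(v,w) ≤ t and ∑_{p prime, p | vw/gcd(v,w)², p ≥ t} 1/p ≥ 10}, where D(v,w) := max(w·ψ(v), v·ψ(w))/gcd(v,w). Then ∑_{(v,w)∈ℰ_t} (ψ(v)φ(v)/v)·(ψ(w)φ(w)/w) ≪ 1/t, with an absolute implied constant. -/

import Mathlib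

/-- `∑_{p prime, p | k, p ≥ t} 1/p`. -/
noncomputable def primeSum (t : ℝ) (k : ℕ) : ℝ :=
  ∑ p ∈ k.primeFactors, Set.indicator {q : ℕ | t ≤ (q : ℝ)} (fun q => 1 / (q : ℝ)) p

/-- `D(v,w) = max(w ψ(v), v ψ(w)) / gcd(v,w)`. -/
noncomputable def Dfun (ψ : ℕ → ℝ) (v w : ℕ) : ℝ :=
  max ((w : ℝ) * ψ v) ((v : ℝ) * ψ w) / (Nat.gcd v w : ℝ)

lemma km_Qbound (s t : Finset ℕ) (c : ℕ → ℕ → ℝ) (κ : ℝ) (α β : ℕ → ℝ) (hc : ∀ i j, 0 ≤ c i j)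
    (hκ : 0 ≤ κ) (hα : ∀ i, 0 ≤ α i) (hβ : ∀ i, 0 ≤ β i)
    (hrow : ∀ i, ∑ j ∈ t, c i j ≤ κ) (hcol : ∀ j, ∑ i ∈ s, c i j ≤ κ) :
    ∑ i ∈ s, ∑ j ∈ t, c i j * (α i * β j) ^ (3/4 : ℝ)
      ≤ κ * ((∑ i ∈ s, α i) * (∑ j ∈ t, β j)) ^ (3/4 : ℝ) := by
  set X := ∑ i ∈ s, α i with hX
  set Y := ∑ j ∈ t, β j with hY
  have hX0 : 0 ≤ X := Finset.sum_nonneg fun i _ => hα i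
  have hY0 : 0 ≤ Y := Finset.sum_nonneg fun i _ => hβ i
  have key : ∀ (x X : ℝ), 0 ≤ x → x ≤ X → x ^ (3/2 : ℝ) ≤ x * X ^ (1/2 : ℝ) := by
    intro x X hx hxX
    have : x ^ (3/2 : ℝ) = x * x ^ (1/2 : ℝ) := by
      rw [show (3/2 : ℝ) = 1 + 1/2 by norm_num, Real.rpow_add_of_nonneg hx (by norm_num) (by norm_num),
        Real.rpow_one]
    rw [this]
    gcongr
  have key2 : ∀ X : ℝ, 0 ≤ X → X * X ^ (1/2 : ℝ) = X ^ (3/2 : ℝ) := by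
    intro x hx
    rw [show (3/2 : ℝ) = 1 + 1/2 by norm_num, Real.rpow_add_of_nonneg hx (by norm_num) (by norm_num),
        Real.rpow_one]
  have h1 : ∑ ij ∈ s ×ˢ t, c ij.1 ij.2 * α ij.1 ^ (3/2 : ℝ) ≤ κ * X ^ (3/2 : ℝ) := by
    rw [Finset.sum_product]
    calc ∑ i ∈ s, ∑ j ∈ t, c i j * α i ^ (3/2 : ℝ)
        = ∑ i ∈ s, (∑ j ∈ t, c i j) * α i ^ (3/2 : ℝ) := by simp_rw [Finset.sum_mul]
      _ ≤ ∑ i ∈ s, κ * (α i * X ^ (1/2 : ℝ)) := by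
          apply Finset.sum_le_sum
          intro i hi
          apply mul_le_mul (hrow i) _ (Real.rpow_nonneg (hα i) _) hκ
          exact key _ _ (hα i) (Finset.single_le_sum (fun i _ => hα i) hi)
      _ = κ * X ^ (3/2 : ℝ) := by
          rw [← Finset.mul_sum, ← Finset.sum_mul, key2 X hX0]
  have h2 : ∑ ij ∈ s ×ˢ t, c ij.1 ij.2 * β ij.2 ^ (3/2 : ℝ) ≤ κ * Y ^ (3/2 : ℝ) := by
    rw [Finset.sum_product_right]
    calc ∑ j ∈ t, ∑ i ∈ s, c i j * β j ^ (3/2 : ℝ)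
        = ∑ j ∈ t, (∑ i ∈ s, c i j) * β j ^ (3/2 : ℝ) := by simp_rw [Finset.sum_mul]
      _ ≤ ∑ j ∈ t, κ * (β j * Y ^ (1/2 : ℝ)) := by
          apply Finset.sum_le_sum
          intro i hi
          apply mul_le_mul (hcol i) _ (Real.rpow_nonneg (hβ i) _) hκ
          exact key _ _ (hβ i) (Finset.single_le_sum (fun i _ => hβ i) hi)
      _ = κ * Y ^ (3/2 : ℝ) := by
          rw [← Finset.mul_sum, ← Finset.sum_mul, key2 Y hY0]
  rw [← Finset.sum_product']
  have sq : ∀ x : ℝ, 0 ≤ x → (x ^ (3/4 : ℝ)) ^ 2 = x ^ (3/2 : ℝ) := by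
    intro x hx
    rw [← Real.rpow_natCast, ← Real.rpow_mul hx]; norm_num
  have cs := Finset.sum_sq_le_sum_mul_sum_of_sq_le_mul (s ×ˢ t)
    (r := fun ij => c ij.1 ij.2 * (α ij.1 * β ij.2) ^ (3/4 : ℝ))
    (f := fun ij => c ij.1 ij.2 * α ij.1 ^ (3/2 : ℝ))
    (g := fun ij => c ij.1 ij.2 * β ij.2 ^ (3/2 : ℝ))
    (fun ij _ => mul_nonneg (hc _ _) (Real.rpow_nonneg (hα _) _))
    (fun ij _ => mul_nonneg (hc _ _) (Real.rpow_nonneg (hβ _) _))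
    (fun ij _ => by
      rw [mul_pow, sq _ (mul_nonneg (hα _) (hβ _)), Real.mul_rpow (hα _) (hβ _)]
      apply le_of_eq; ring)
  refine le_of_sq_le_sq (cs.trans ?_) (by positivity)
  rw [mul_pow, sq _ (by positivity), Real.mul_rpow hX0 hY0]
  calc _ ≤ (κ * X ^ (3/2 : ℝ)) * (κ * Y ^ (3/2 : ℝ)) := by
        apply mul_le_mul h1 h2 _ (by positivity)
        exact Finset.sum_nonneg fun ij _ => mul_nonneg (hc _ _) (Real.rpow_nonneg (hβ _) _)
    _ = _ := by ring

/-- off-diagonal coefficients -/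
noncomputable def kmO (r : ℝ) (i j : ℕ) : ℝ := if i = j then 0 else 3 * r ^ ((i - j) + (j - i))

/-- diagonal coefficients -/
noncomputable def kmD (i j : ℕ) : ℝ := if i = j then 1 else 0

lemma kmO_nonneg {r : ℝ} (hr : 0 ≤ r) (i j : ℕ) : 0 ≤ kmO r i j := by
  unfold kmO; split_ifs <;> positivity

lemma kmD_nonneg (i j : ℕ) : 0 ≤ kmD i j := by
  unfold kmD; split_ifs <;> norm_num

lemma kmO_symm (r : ℝ) (i j : ℕ) : kmO r i j = kmO r j i := by
  unfold kmO
  rw [add_comm]; simp only [eq_comm]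

lemma km_geom {r : ℝ} (hr : 0 ≤ r) (hr1 : r < 1) (u : Finset ℕ) (f : ℕ → ℕ) (hf : Set.InjOn f u)
    (hpos : ∀ x ∈ u, 1 ≤ f x) : ∑ x ∈ u, r ^ f x ≤ r / (1 - r) := by
  have hs : Summable (fun n : ℕ => r ^ (n + 1)) := by
    simpa [pow_succ] using (summable_geometric_of_lt_one hr hr1).mul_right r
  have ht : ∑' n : ℕ, r ^ (n + 1) = r / (1 - r) := by
    simp_rw [pow_succ]; rw [tsum_mul_right, tsum_geometric_of_lt_one hr hr1]; field_simp
  rw [← ht]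
  have : ∑ x ∈ u, r ^ f x = ∑ n ∈ u.image (fun x => f x - 1), r ^ (n + 1) := by
    rw [Finset.sum_image]
    · apply Finset.sum_congr rfl
      intro x hx
      have := hpos x hx
      congr 1; omega
    · intro x hx y hy hxy
      apply hf hx hy
      have h1 := hpos x hx
      have h2 := hpos y hy
      simp only at hxy
      omega
  rw [this]
  exact hs.sum_le_tsum _ (fun i _ => by positivity)

lemma kmO_row {r : ℝ} (hr : 0 ≤ r) (hr1 : r < 1) (t : Finset ℕ) (i : ℕ) :
    ∑ j ∈ t, kmO r i j ≤ 6 * r / (1 - r) := by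
  have h1 : ∑ j ∈ t, kmO r i j = 3 * ∑ j ∈ t with j < i, r ^ (i - j)
      + 3 * ∑ j ∈ t with i < j, r ^ (j - i) := by
    rw [Finset.mul_sum, Finset.mul_sum, Finset.sum_filter, Finset.sum_filter,
      ← Finset.sum_add_distrib]
    apply Finset.sum_congr rfl
    intro j _
    unfold kmO
    rcases lt_trichotomy i j with h | h | h
    · simp [h, h.ne, not_lt.mpr h.le, Nat.sub_eq_zero_of_le h.le]
    · simp [h]
    · simp [h, h.ne', not_lt.mpr h.le, Nat.sub_eq_zero_of_le h.le]
  rw [h1]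
  have a1 := km_geom hr hr1 (t.filter (· < i)) (fun j => i - j)
    (by intro x hx y hy h; simp at hx hy h; omega) (by intro x hx; simp at hx; omega)
  have a2 := km_geom hr hr1 (t.filter (i < ·)) (fun j => j - i)
    (by intro x hx y hy h; simp at hx hy h; omega) (by intro x hx; simp at hx; omega)
  calc _ ≤ 3 * (r / (1 - r)) + 3 * (r / (1 - r)) := by gcongr
    _ = _ := by ring

lemma kmD_row (t : Finset ℕ) (i : ℕ) : ∑ j ∈ t, kmD i j ≤ 1 := by
  unfold kmD
  rw [Finset.sum_ite_eq]; split_ifs <;> norm_num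

lemma kmD_symm (i j : ℕ) : kmD i j = kmD j i := by
  unfold kmD; simp only [eq_comm]

lemma kmO_bound {r : ℝ} (hr : 0 ≤ r) (hr1 : r < 1) (s t : Finset ℕ) (α β : ℕ → ℝ)
    (hα : ∀ i, 0 ≤ α i) (hβ : ∀ i, 0 ≤ β i) :
    ∑ i ∈ s, ∑ j ∈ t, kmO r i j * (α i * β j) ^ (3/4 : ℝ)
      ≤ (6 * r / (1 - r)) * ((∑ i ∈ s, α i) * (∑ j ∈ t, β j)) ^ (3/4 : ℝ) := by
  have : 0 < 1 - r := by linarith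
  exact km_Qbound s t (kmO r) _ α β (kmO_nonneg hr) (by positivity) hα hβ
    (kmO_row hr hr1 t) (fun j => by simp_rw [kmO_symm r _ j]; exact kmO_row hr hr1 s j)

lemma kmD_bound (s t : Finset ℕ) (α β : ℕ → ℝ)
    (hα : ∀ i, 0 ≤ α i) (hβ : ∀ i, 0 ≤ β i) :
    ∑ i ∈ s, ∑ j ∈ t, kmD i j * (α i * β j) ^ (3/4 : ℝ)
      ≤ ((∑ i ∈ s, α i) * (∑ j ∈ t, β j)) ^ (3/4 : ℝ) := by
  have := km_Qbound s t kmD 1 α β kmD_nonneg (by positivity) hα hβ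
    (kmD_row t) (fun j => by simp_rw [kmD_symm _ j]; exact kmD_row s j)
  simpa using this

/-- combined term -/
noncomputable def kmE (r : ℝ) (α β : ℕ → ℝ) (i j : ℕ) : ℝ :=
  (kmD i j + kmO r i j) * (α i * β j) ^ (3/4 : ℝ)

lemma kmE_total {r : ℝ} (hr : 0 ≤ r) (hr1 : r < 1) (s t : Finset ℕ) (α β : ℕ → ℝ)
    (hα : ∀ i, 0 ≤ α i) (hβ : ∀ i, 0 ≤ β i) :
    ∑ i ∈ s, ∑ j ∈ t, kmE r α β i j
      ≤ (1 + 6 * r / (1 - r)) * ((∑ i ∈ s, α i) * (∑ j ∈ t, β j)) ^ (3/4 : ℝ) := by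
  have h1 := kmO_bound hr hr1 s t α β hα hβ
  have h2 := kmD_bound s t α β hα hβ
  unfold kmE
  simp_rw [add_mul, Finset.sum_add_distrib]
  linarith

set_option maxHeartbeats 1000000 in
lemma km_key {r : ℝ} (hr : 0 < r) (hr1 : r ≤ 1/768) (n : ℕ) (α β : ℕ → ℝ)
    (hα : ∀ i, 0 ≤ α i) (hβ : ∀ i, 0 ≤ β i)
    (hα1 : ∑ i ∈ Finset.range n, α i = 1) (hβ1 : ∑ i ∈ Finset.range n, β i = 1)
    (h : 1 ≤ ∑ i ∈ Finset.range n, ∑ j ∈ Finset.range n, kmE r α β i j) :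
    ∃ k, (∑ i ∈ Finset.range n, ∑ j ∈ Finset.range n,
            if i = k ∧ j = k then 0 else kmE r α β i j) ≤ (2 * 72 ^ 6) * r ^ 4 ∧
      (∑ i ∈ Finset.range n, ∑ j ∈ Finset.range n,
            if i = k ∨ j = k then 0 else kmE r α β i j) ≤ (2 * 72 ^ 6) * r ^ 6 := by
  set s := Finset.range n with hs
  have hr1' : r < 1 := by linarith
  set κ := 6 * r / (1 - r) with hκ
  have hκ0 : 0 ≤ κ := by
    have : 0 < 1 - r := by linarith
    positivity
  have hκ12 : κ ≤ 12 * r := by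
    rw [hκ, div_le_iff₀ (by linarith)]; nlinarith
  have hne : s.Nonempty := by
    by_contra hcon
    rw [Finset.not_nonempty_iff_eq_empty] at hcon
    rw [hcon] at hα1; simp at hα1
  obtain ⟨k, hk, hmax⟩ := Finset.exists_max_image s (fun i => α i * β i) hne
  refine ⟨k, ?_⟩
  have hαle : ∀ i ∈ s, α i ≤ 1 := fun i hi => by
    rw [← hα1]; exact Finset.single_le_sum (fun i _ => hα i) hi
  have hβle : ∀ i ∈ s, β i ≤ 1 := fun i hi => by
    rw [← hβ1]; exact Finset.single_le_sum (fun i _ => hβ i) hi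
  have hx : ∑ i ∈ s.erase k, α i = 1 - α k := by
    rw [← hα1, ← Finset.add_sum_erase s α hk]; ring
  have hy : ∑ i ∈ s.erase k, β i = 1 - β k := by
    rw [← hβ1, ← Finset.add_sum_erase s β hk]; ring
  -- first stage
  have st1 : ∑ i ∈ s, ∑ j ∈ s, kmE r α β i j ≤ (α k * β k) ^ (1/4 : ℝ) + κ := by
    have h1 := kmO_bound hr.le hr1' s s α β hα hβ
    rw [hα1, hβ1] at h1
    have h2 : ∑ i ∈ s, ∑ j ∈ s, kmD i j * (α i * β j) ^ (3/4 : ℝ) ≤ (α k * β k) ^ (1/4 : ℝ) := by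
      have : ∀ i ∈ s, ∑ j ∈ s, kmD i j * (α i * β j) ^ (3/4 : ℝ)
          ≤ (α k * β k) ^ (1/4 : ℝ) * ((α i + β i) / 2) := by
        intro i hi
        have e1 : ∑ j ∈ s, kmD i j * (α i * β j) ^ (3/4 : ℝ) = (α i * β i) ^ (3/4 : ℝ) := by
          unfold kmD
          simp [hi]
        have hp := mul_nonneg (hα i) (hβ i)
        rw [e1, show (3/4 : ℝ) = 1/4 + 1/2 by norm_num,
          Real.rpow_add_of_nonneg hp (by norm_num) (by norm_num)]
        apply mul_le_mul _ _ (Real.rpow_nonneg hp _) (Real.rpow_nonneg (mul_nonneg (hα k) (hβ k)) _)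
        · exact Real.rpow_le_rpow hp (hmax i hi) (by norm_num)
        · rw [← Real.sqrt_eq_rpow]
          apply Real.sqrt_le_iff.mpr
          have := hα i
          have := hβ i
          refine ⟨by positivity, ?_⟩
          nlinarith [sq_nonneg (α i - β i)]
      refine (Finset.sum_le_sum this).trans ?_
      rw [← Finset.mul_sum, ← Finset.sum_div, Finset.sum_add_distrib, hα1, hβ1]
      norm_num
    unfold kmE
    simp_rw [add_mul, Finset.sum_add_distrib]
    simp at h1
    linarith
  have hP0 : 0 ≤ α k * β k := mul_nonneg (hα k) (hβ k)
  have hP : 1 - 4 * κ ≤ α k * β k := by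
    have h1 : 1 - κ ≤ (α k * β k) ^ (1/4 : ℝ) := by linarith
    have h2 : ((α k * β k) ^ (1/4 : ℝ)) ^ 4 = α k * β k := by
      rw [← Real.rpow_natCast, ← Real.rpow_mul hP0]; norm_num
    have h3 : (1 - κ) ^ 4 ≤ α k * β k := by
      rw [← h2]; exact pow_le_pow_left₀ (by linarith) h1 4
    have h4 := one_add_mul_le_pow (a := -κ) (by linarith) 4
    have h5 : (1 + -κ) ^ 4 = (1 - κ) ^ 4 := by ring
    rw [h5] at h4
    push_cast at h4
    linarith
  have hak := hαle k hk
  have hbk := hβle k hk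
  have ha0 := hα k
  have hb0 := hβ k
  set z := max (1 - α k) (1 - β k) with hz
  have hz0 : 0 ≤ z := le_trans (by linarith) (le_max_left _ _)
  have hzκ : z ≤ 4 * κ := by
    apply max_le <;> nlinarith
  set Z := z ^ (1/4 : ℝ) with hZ
  have hZ0 : 0 ≤ Z := Real.rpow_nonneg hz0 _
  have hZ4 : Z ^ 4 = z := by
    rw [hZ, ← Real.rpow_natCast, ← Real.rpow_mul hz0]; norm_num
  have hZ3 : Z ^ 3 = z ^ (3/4 : ℝ) := by
    rw [hZ, ← Real.rpow_natCast, ← Real.rpow_mul hz0]; norm_num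
  have hZ6 : Z ^ 6 = (z * z) ^ (3/4 : ℝ) := by
    rw [Real.mul_rpow hz0 hz0, ← hZ3]; ring
  have hZhalf : Z ≤ 1/2 := by
    by_contra hcon
    push Not at hcon
    have : (1/2 : ℝ) ^ 4 < Z ^ 4 := pow_lt_pow_left₀ hcon (by norm_num) (by norm_num)
    rw [hZ4] at this
    norm_num at this
    linarith
  have hxz : ∑ i ∈ s.erase k, α i ≤ z := hx ▸ le_max_left _ _
  have hyz : ∑ i ∈ s.erase k, β i ≤ z := hy ▸ le_max_right _ _
  have hx0 : 0 ≤ ∑ i ∈ s.erase k, α i := by rw [hx]; linarith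
  have hy0 : 0 ≤ ∑ i ∈ s.erase k, β i := by rw [hy]; linarith
  -- pieces
  have p1 : ∑ j ∈ s.erase k, kmE r α β k j ≤ κ * Z ^ 3 := by
    have h1 := kmO_bound hr.le hr1' {k} (s.erase k) α β hα hβ
    rw [Finset.sum_singleton, Finset.sum_singleton] at h1
    calc _ = ∑ j ∈ s.erase k, kmO r k j * (α k * β j) ^ (3/4 : ℝ) := by
          apply Finset.sum_congr rfl
          intro j hj
          have := (Finset.ne_of_mem_erase hj).symm
          simp [kmE, kmD, this]
      _ ≤ _ := h1
      _ ≤ _ := by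
          rw [hZ3]
          gcongr
          nlinarith
  have p2 : ∑ i ∈ s.erase k, kmE r α β i k ≤ κ * Z ^ 3 := by
    have h1 := kmO_bound hr.le hr1' (s.erase k) {k} α β hα hβ
    simp_rw [Finset.sum_singleton] at h1
    calc _ = ∑ i ∈ s.erase k, kmO r i k * (α i * β k) ^ (3/4 : ℝ) := by
          apply Finset.sum_congr rfl
          intro j hj
          have := (Finset.ne_of_mem_erase hj)
          simp [kmE, kmD, this]
      _ ≤ _ := h1
      _ ≤ _ := by
          rw [hZ3]
          gcongr
          nlinarith
  have p3 : ∑ i ∈ s.erase k, ∑ j ∈ s.erase k, kmE r α β i j ≤ (1 + κ) * Z ^ 6 := by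
    have h1 := kmE_total hr.le hr1' (s.erase k) (s.erase k) α β hα hβ
    refine h1.trans ?_
    rw [hZ6]
    gcongr
  have p0 : kmE r α β k k ≤ 1 - 3/4 * Z ^ 4 := by
    have e : kmE r α β k k = (α k * β k) ^ (3/4 : ℝ) := by simp [kmE, kmD, kmO]
    rw [e, hZ4]
    have h1 : α k * β k ≤ 1 + -z := by
      rcases max_choice (1 - α k) (1 - β k) with h | h <;> rw [hz, h] <;> nlinarith
    calc _ ≤ (1 + -z) ^ (3/4 : ℝ) := Real.rpow_le_rpow hP0 h1 (by norm_num)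
      _ ≤ 1 + 3/4 * -z := rpow_one_add_le_one_add_mul_self (by linarith) (by norm_num) (by norm_num)
      _ = _ := by ring
  have d1 : ∀ g : ℕ → ℕ → ℝ, ∑ i ∈ s, ∑ j ∈ s, g i j = g k k + ∑ j ∈ s.erase k, g k j
      + ∑ i ∈ s.erase k, g i k + ∑ i ∈ s.erase k, ∑ j ∈ s.erase k, g i j := by
    intro g
    rw [← Finset.add_sum_erase s _ hk, ← Finset.add_sum_erase s (g k) hk]
    have : ∑ i ∈ s.erase k, ∑ j ∈ s, g i j
        = ∑ i ∈ s.erase k, (g i k + ∑ j ∈ s.erase k, g i j) := by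
      apply Finset.sum_congr rfl
      intro i _
      rw [← Finset.add_sum_erase s (g i) hk]
    rw [this, Finset.sum_add_distrib]; ring
  rw [d1] at h
  have hZr : Z ≤ 72 * r := by
    rcases hZ0.eq_or_lt with h0 | h0
    · rw [← h0]; positivity
    · have h1 : 0 ≤ -(3/4 * Z ^ 4) + 2 * (κ * Z ^ 3) + (1 + κ) * Z ^ 6 := by linarith
      have h3 : 0 < Z ^ 3 := by positivity
      have h2 : 0 ≤ Z ^ 3 * (-(3/4 * Z) + 2 * κ + (1 + κ) * Z ^ 3) := by
        refine h1.trans (le_of_eq ?_); ring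
      have h4 : 0 ≤ -(3/4 * Z) + 2 * κ + (1 + κ) * Z ^ 3 := nonneg_of_mul_nonneg_right h2 h3
      have h50 : Z ^ 2 ≤ (1/2) ^ 2 := pow_le_pow_left₀ hZ0 hZhalf 2
      have h51 : Z * Z ^ 2 ≤ Z * (1/2) ^ 2 := mul_le_mul_of_nonneg_left h50 hZ0
      have h5 : Z ^ 3 ≤ Z / 4 := by
        calc Z ^ 3 = Z * Z ^ 2 := by ring
          _ ≤ _ := h51
          _ = _ := by ring
      have h6 : κ * Z ^ 3 ≤ κ * 1 :=
        mul_le_mul_of_nonneg_left (by linarith) hκ0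
      linarith
  have hκ1 : κ ≤ 1 := by linarith
  have hb6 : Z ^ 6 ≤ 72 ^ 6 * r ^ 6 := by
    rw [← mul_pow]; exact pow_le_pow_left₀ hZ0 hZr 6
  have hb3 : Z ^ 3 ≤ 72 ^ 3 * r ^ 3 := by
    rw [← mul_pow]; exact pow_le_pow_left₀ hZ0 hZr 3
  have hr2 : r ^ 2 ≤ 1 / 768 ^ 2 := by
    calc r ^ 2 ≤ (1/768) ^ 2 := pow_le_pow_left₀ hr.le hr1 2
      _ = _ := by norm_num
  have hr64 : r ^ 6 ≤ r ^ 4 * (1 / 768 ^ 2) := by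
    calc r ^ 6 = r ^ 4 * r ^ 2 := by ring
      _ ≤ _ := by gcongr
  have hκZ : κ * Z ^ 3 ≤ 12 * 72 ^ 3 * r ^ 4 := by
    calc κ * Z ^ 3 ≤ (12 * r) * (72 ^ 3 * r ^ 3) := by gcongr
      _ = _ := by ring
  have hκZ6 : (1 + κ) * Z ^ 6 ≤ 2 * (72 ^ 6 * r ^ 6) := by
    gcongr; linarith
  have ne : ∀ i ∈ s.erase k, i ≠ k := fun i hi => Finset.ne_of_mem_erase hi
  constructor
  · rw [d1]
    have q0 : (∑ j ∈ s.erase k, if k = k ∧ j = k then 0 else kmE r α β k j)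
        = ∑ j ∈ s.erase k, kmE r α β k j := Finset.sum_congr rfl fun j hj => by simp [ne j hj]
    have q1 : (∑ j ∈ s.erase k, if j = k ∧ k = k then 0 else kmE r α β j k)
        = ∑ j ∈ s.erase k, kmE r α β j k := Finset.sum_congr rfl fun j hj => by simp [ne j hj]
    have q2 : (∑ i ∈ s.erase k, ∑ j ∈ s.erase k, if i = k ∧ j = k then 0 else kmE r α β i j)
        = ∑ i ∈ s.erase k, ∑ j ∈ s.erase k, kmE r α β i j :=
      Finset.sum_congr rfl fun i hi => Finset.sum_congr rfl fun j hj => by simp [ne j hj]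
    rw [q0, q1, q2]
    simp only [and_self, if_true]
    have : 0 ≤ r ^ 4 := by positivity
    linarith
  · rw [d1]
    have q2 : (∑ i ∈ s.erase k, ∑ j ∈ s.erase k, if i = k ∨ j = k then 0 else kmE r α β i j)
        = ∑ i ∈ s.erase k, ∑ j ∈ s.erase k, kmE r α β i j :=
      Finset.sum_congr rfl fun i hi => Finset.sum_congr rfl fun j hj => by simp [ne j hj, ne i hi]
    rw [q2]
    simp
    linarith

/-- `v / gcd(v,w)` restricted to primes in `P` -/
def kmUp (a : ℕ → ℕ → ℕ) (P : Finset ℕ) (v w : ℕ) : ℕ := ∏ p ∈ P, p ^ (a v p - a w p)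

/-- local density factor -/
noncomputable def kmU (p i : ℕ) : ℝ := if i = 0 then 1 else 1 - 1 / (p : ℝ)

/-- `φ(v)/v` restricted to primes in `P` -/
noncomputable def kmRho (a : ℕ → ℕ → ℕ) (P : Finset ℕ) (v : ℕ) : ℝ := ∏ p ∈ P, kmU p (a v p)

/-- weights -/
noncomputable def kmS (h : ℕ → ℝ) (a : ℕ → ℕ → ℕ) (P : Finset ℕ) (v w : ℕ) : ℝ :=
  ∏ p ∈ P, if a v p = a w p then 1 else Real.exp (h p)

open Classical in
/-- weighted edges -/
noncomputable def kmPhi (h : ℕ → ℝ) (a : ℕ → ℕ → ℕ) (P : Finset ℕ) (ψ θ : ℕ → ℝ) (v w : ℕ) : ℝ :=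
  if ψ v * kmUp a P w v ≤ 1 ∧ θ w * kmUp a P v w ≤ 1 then
    (ψ v * kmRho a P v) * (θ w * kmRho a P w) * kmS h a P v w else 0

/-- injectivity of the exponent vector -/
def kmInj (a : ℕ → ℕ → ℕ) (P V : Finset ℕ) : Prop :=
  ∀ v ∈ V, ∀ v' ∈ V, (∀ p ∈ P, a v p = a v' p) → v = v'

/-- mass -/
noncomputable def kmMu (a : ℕ → ℕ → ℕ) (P V : Finset ℕ) (ψ : ℕ → ℝ) : ℝ :=
  ∑ v ∈ V, ψ v * kmRho a P v

/-- the main inequality -/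
def kmClaim (h : ℕ → ℝ) (a : ℕ → ℕ → ℕ) (P : Finset ℕ) (K : ℝ) : Prop :=
  ∀ (V W : Finset ℕ) (ψ θ : ℕ → ℝ), (∀ v, 0 ≤ ψ v) → (∀ v, 0 ≤ θ v) →
    kmInj a P V → kmInj a P W →
    ∑ v ∈ V, ∑ w ∈ W, kmPhi h a P ψ θ v w ≤ K * (kmMu a P V ψ * kmMu a P W θ) ^ (3/4 : ℝ)

lemma kmU_nonneg (p i : ℕ) : 0 ≤ kmU p i := by
  unfold kmU; split_ifs
  · norm_num
  · rcases Nat.eq_zero_or_pos p with h | h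
    · simp [h]
    · have : (1:ℝ) ≤ p := by exact_mod_cast h
      rw [sub_nonneg, div_le_one (by linarith)]; exact this

lemma kmU_le_one (p i : ℕ) : kmU p i ≤ 1 := by
  unfold kmU; split_ifs
  · norm_num
  · have : (0:ℝ) ≤ 1 / p := by positivity
    linarith

lemma kmRho_nonneg (a : ℕ → ℕ → ℕ) (P : Finset ℕ) (v : ℕ) : 0 ≤ kmRho a P v :=
  Finset.prod_nonneg fun _ _ => kmU_nonneg _ _

lemma kmS_nonneg (h : ℕ → ℝ) (a : ℕ → ℕ → ℕ) (P : Finset ℕ) (v w : ℕ) : 0 ≤ kmS h a P v w :=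
  Finset.prod_nonneg fun _ _ => by split_ifs <;> positivity

lemma kmPhi_nonneg (h : ℕ → ℝ) (a : ℕ → ℕ → ℕ) (P : Finset ℕ) (ψ θ : ℕ → ℝ)
    (hψ : ∀ v, 0 ≤ ψ v) (hθ : ∀ v, 0 ≤ θ v) (v w : ℕ) : 0 ≤ kmPhi h a P ψ θ v w := by
  unfold kmPhi
  split_ifs
  · exact mul_nonneg (mul_nonneg (mul_nonneg (hψ _) (kmRho_nonneg _ _ _))
      (mul_nonneg (hθ _) (kmRho_nonneg _ _ _))) (kmS_nonneg _ _ _ _ _)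
  · exact le_rfl

lemma kmMu_nonneg (a : ℕ → ℕ → ℕ) (P V : Finset ℕ) (ψ : ℕ → ℝ) (hψ : ∀ v, 0 ≤ ψ v) :
    0 ≤ kmMu a P V ψ := Finset.sum_nonneg fun _ _ => mul_nonneg (hψ _) (kmRho_nonneg _ _ _)

/-- decay rate -/
noncomputable def kmR (p : ℕ) : ℝ := (p : ℝ) ^ (-(1/4) : ℝ)

lemma km_step (h : ℕ → ℝ) (a : ℕ → ℕ → ℕ) (P : Finset ℕ) (p : ℕ) (K : ℝ) (hp : p ∉ P)
    (hp2 : 2 ≤ p) (hh : h p ≤ 1) (hK : 0 ≤ K) (IH : kmClaim h a P K)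
    (V W : Finset ℕ) (ψ θ : ℕ → ℝ) (hψ : ∀ v, 0 ≤ ψ v) (hθ : ∀ v, 0 ≤ θ v)
    (hV : kmInj a (insert p P) V) (hW : kmInj a (insert p P) W) (i j : ℕ) :
    ∑ v ∈ V with a v p = i, ∑ w ∈ W with a w p = j, kmPhi h a (insert p P) ψ θ v w
      ≤ K * ((kmD i j + kmO (kmR p) i j) *
        (kmMu a (insert p P) (V.filter (fun v => a v p = i)) ψ *
         kmMu a (insert p P) (W.filter (fun w => a w p = j)) θ) ^ (3/4 : ℝ)) := by
  have hp0 : (0 : ℝ) < p := by exact_mod_cast (by omega : 0 < p)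
  set V' := V.filter (fun v => a v p = i) with hV'
  set W' := W.filter (fun w => a w p = j) with hW'
  set d := j - i with hd
  set e := i - j with he
  have hV'i : ∀ v ∈ V', a v p = i := fun v hv => (Finset.mem_filter.mp hv).2
  have hW'i : ∀ v ∈ W', a v p = j := fun v hv => (Finset.mem_filter.mp hv).2
  have iV : kmInj a P V' := by
    intro v hv v' hv' H
    apply hV v (Finset.mem_filter.mp hv).1 v' (Finset.mem_filter.mp hv').1
    intro q hq
    rcases Finset.mem_insert.mp hq with rfl | hq
    · rw [hV'i v hv, hV'i v' hv']
    · exact H q hq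
  have iW : kmInj a P W' := by
    intro v hv v' hv' H
    apply hW v (Finset.mem_filter.mp hv).1 v' (Finset.mem_filter.mp hv').1
    intro q hq
    rcases Finset.mem_insert.mp hq with rfl | hq
    · rw [hW'i v hv, hW'i v' hv']
    · exact H q hq
  have ih := IH V' W' (fun v => (p:ℝ) ^ d * ψ v) (fun w => (p:ℝ) ^ e * θ w)
    (fun v => mul_nonneg (by positivity) (hψ v)) (fun v => mul_nonneg (by positivity) (hθ v)) iV iW
  have rV : ∀ v ∈ V', kmRho a (insert p P) v = kmU p i * kmRho a P v := fun v hv => by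
    unfold kmRho; rw [Finset.prod_insert hp, hV'i v hv]
  have rW : ∀ v ∈ W', kmRho a (insert p P) v = kmU p j * kmRho a P v := fun v hv => by
    unfold kmRho; rw [Finset.prod_insert hp, hW'i v hv]
  set sg : ℝ := if i = j then 1 else Real.exp (h p) with hsg
  have hsg0 : 0 ≤ sg := by rw [hsg]; split_ifs <;> positivity
  have hphi : ∀ v ∈ V', ∀ w ∈ W', kmPhi h a (insert p P) ψ θ v w =
      (((p:ℝ) ^ (e + d))⁻¹ * (kmU p i * kmU p j) * sg) *
        kmPhi h a P (fun v => (p:ℝ) ^ d * ψ v) (fun w => (p:ℝ) ^ e * θ w) v w := by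
    intro v hv w hw
    have u1 : (kmUp a (insert p P) w v : ℝ) = (p:ℝ) ^ d * kmUp a P w v := by
      unfold kmUp; rw [Finset.prod_insert hp, hV'i v hv, hW'i w hw]; push_cast; rfl
    have u2 : (kmUp a (insert p P) v w : ℝ) = (p:ℝ) ^ e * kmUp a P v w := by
      unfold kmUp; rw [Finset.prod_insert hp, hV'i v hv, hW'i w hw]; push_cast; rfl
    have u3 : kmS h a (insert p P) v w = sg * kmS h a P v w := by
      unfold kmS; rw [Finset.prod_insert hp, hV'i v hv, hW'i w hw]
    unfold kmPhi
    have c1 : ψ v * kmUp a (insert p P) w v = (p:ℝ) ^ d * ψ v * kmUp a P w v := by rw [u1]; ring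
    have c2 : θ w * kmUp a (insert p P) v w = (p:ℝ) ^ e * θ w * kmUp a P v w := by rw [u2]; ring
    rw [c1, c2, rV v hv, rW w hw, u3]
    split_ifs
    · rw [pow_add]; field_simp
    · simp
  have muV : kmMu a (insert p P) V' ψ = kmU p i * kmMu a P V' ψ := by
    unfold kmMu; rw [Finset.mul_sum]
    exact Finset.sum_congr rfl fun v hv => by rw [rV v hv]; ring
  have muW : kmMu a (insert p P) W' θ = kmU p j * kmMu a P W' θ := by
    unfold kmMu; rw [Finset.mul_sum]
    exact Finset.sum_congr rfl fun v hv => by rw [rW v hv]; ring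
  have muV2 : kmMu a P V' (fun v => (p:ℝ) ^ d * ψ v) = (p:ℝ) ^ d * kmMu a P V' ψ := by
    unfold kmMu; rw [Finset.mul_sum]
    exact Finset.sum_congr rfl fun v hv => by ring
  have muW2 : kmMu a P W' (fun w => (p:ℝ) ^ e * θ w) = (p:ℝ) ^ e * kmMu a P W' θ := by
    unfold kmMu; rw [Finset.mul_sum]
    exact Finset.sum_congr rfl fun v hv => by ring
  rw [muV2, muW2] at ih
  have m1 := kmMu_nonneg a P V' ψ hψ
  have m2 := kmMu_nonneg a P W' θ hθ
  set mV := kmMu a P V' ψ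
  set mW := kmMu a P W' θ
  have hui := kmU_nonneg p i
  have huj := kmU_nonneg p j
  have hu1 : kmU p i * kmU p j ≤ 1 := mul_le_one₀ (kmU_le_one _ _) huj (kmU_le_one _ _)
  have hu0 : 0 ≤ kmU p i * kmU p j := mul_nonneg hui huj
  set u := kmU p i * kmU p j with hu
  have hsum : ∑ v ∈ V', ∑ w ∈ W', kmPhi h a (insert p P) ψ θ v w =
      (((p:ℝ) ^ (e + d))⁻¹ * u * sg) * ∑ v ∈ V', ∑ w ∈ W',
        kmPhi h a P (fun v => (p:ℝ) ^ d * ψ v) (fun w => (p:ℝ) ^ e * θ w) v w := by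
    simp_rw [Finset.mul_sum]
    exact Finset.sum_congr rfl fun v hv => Finset.sum_congr rfl fun w hw => hphi v hv w hw
  rw [hsum, muV, muW]
  have hq : (0:ℝ) < (p:ℝ) ^ (e + d) := by positivity
  calc _ ≤ (((p:ℝ) ^ (e + d))⁻¹ * u * sg) *
        (K * ((p:ℝ) ^ d * mV * ((p:ℝ) ^ e * mW)) ^ (3/4 : ℝ)) := by
        apply mul_le_mul_of_nonneg_left ih; positivity
    _ = K * ((sg * (((p:ℝ) ^ (e + d))⁻¹ * ((p:ℝ) ^ (e + d)) ^ (3/4 : ℝ))) *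
          (u * (mV * mW) ^ (3/4 : ℝ))) := by
        have : (p:ℝ) ^ d * mV * ((p:ℝ) ^ e * mW) = (p:ℝ) ^ (e + d) * (mV * mW) := by
          rw [pow_add]; ring
        rw [this, Real.mul_rpow hq.le (mul_nonneg m1 m2)]
        ring
    _ ≤ K * ((kmD i j + kmO (kmR p) i j) * (u ^ (3/4 : ℝ) * (mV * mW) ^ (3/4 : ℝ))) := by
        have e1 : ((p:ℝ) ^ (e + d))⁻¹ * ((p:ℝ) ^ (e + d)) ^ (3/4 : ℝ) = kmR p ^ (e + d) := by
          unfold kmR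
          rw [← Real.rpow_neg_one, ← Real.rpow_add hq, ← Real.rpow_natCast, ← Real.rpow_natCast,
            ← Real.rpow_mul hp0.le, ← Real.rpow_mul hp0.le]
          congr 1; ring
        have e2 : u ≤ u ^ (3/4 : ℝ) := Real.self_le_rpow_of_le_one hu0 hu1 (by norm_num)
        have hR : 0 ≤ kmR p := Real.rpow_nonneg hp0.le _
        have e3 : sg * kmR p ^ (e + d) ≤ kmD i j + kmO (kmR p) i j := by
          rw [hsg]; unfold kmD kmO
          split_ifs with hij
          · simp [he, hd, hij]
          · rw [zero_add]
            gcongr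
            calc Real.exp (h p) ≤ Real.exp 1 := Real.exp_le_exp.mpr hh
              _ ≤ 3 := by linarith [Real.exp_one_lt_d9]
        rw [e1]
        have := kmD_nonneg i j
        have := kmO_nonneg hR i j
        gcongr
    _ = _ := by
        rw [← Real.mul_rpow hu0 (mul_nonneg m1 m2)]
        congr 3; ring

lemma km_fiber (a : ℕ → ℕ → ℕ) (p n : ℕ) (V W : Finset ℕ) (hV : ∀ v ∈ V, a v p < n)
    (hW : ∀ v ∈ W, a v p < n) (f : ℕ → ℕ → ℝ) :
    ∑ v ∈ V, ∑ w ∈ W, f v w = ∑ i ∈ Finset.range n, ∑ j ∈ Finset.range n,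
      ∑ v ∈ V with a v p = i, ∑ w ∈ W with a w p = j, f v w := by
  rw [← Finset.sum_fiberwise_of_maps_to (t := Finset.range n) (g := fun v => a v p)
    (fun v hv => Finset.mem_range.mpr (hV v hv))]
  apply Finset.sum_congr rfl
  intro i _
  rw [Finset.sum_comm (s := Finset.range n)]
  apply Finset.sum_congr rfl
  intro v _
  rw [← Finset.sum_fiberwise_of_maps_to (t := Finset.range n) (g := fun v => a v p)
    (fun v hv => Finset.mem_range.mpr (hW v hv))]

lemma km_fiber_mu (a : ℕ → ℕ → ℕ) (p n : ℕ) (P V : Finset ℕ) (hV : ∀ v ∈ V, a v p < n)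
    (ψ : ℕ → ℝ) :
    kmMu a P V ψ = ∑ i ∈ Finset.range n, kmMu a P (V.filter (fun v => a v p = i)) ψ := by
  unfold kmMu
  rw [← Finset.sum_fiberwise_of_maps_to (t := Finset.range n) (g := fun v => a v p)
    (fun v hv => Finset.mem_range.mpr (hV v hv))]

lemma km_exists_n (a : ℕ → ℕ → ℕ) (p : ℕ) (V W : Finset ℕ) :
    ∃ n, (∀ v ∈ V, a v p < n) ∧ (∀ v ∈ W, a v p < n) := by
  refine ⟨(V ∪ W).sup (fun v => a v p) + 1, ?_, ?_⟩ <;>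
  · intro v hv
    exact Nat.lt_succ_of_le (Finset.le_sup (f := fun v => a v p) (by simp [hv]))

lemma kmR_lt_one {p : ℕ} (hp : 2 ≤ p) : 0 < kmR p ∧ kmR p < 1 := by
  have : (1:ℝ) < p := by exact_mod_cast (by omega : 1 < p)
  exact ⟨Real.rpow_pos_of_pos (by linarith) _, Real.rpow_lt_one_of_one_lt_of_neg this (by norm_num)⟩

lemma km_small (h : ℕ → ℝ) (a : ℕ → ℕ → ℕ) (P : Finset ℕ) (p : ℕ) (K : ℝ) (hp : p ∉ P)
    (hp2 : 2 ≤ p) (hh : h p ≤ 1) (hK : 0 ≤ K) (IH : kmClaim h a P K) :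
    kmClaim h a (insert p P) (K * (1 + 6 * kmR p / (1 - kmR p))) := by
  intro V W ψ θ hψ hθ hV hW
  obtain ⟨n, hn1, hn2⟩ := km_exists_n a p V W
  rw [km_fiber a p n V W hn1 hn2, km_fiber_mu a p n _ V hn1 ψ, km_fiber_mu a p n _ W hn2 θ]
  obtain ⟨r0, r1⟩ := kmR_lt_one hp2
  have := kmE_total r0.le r1 (Finset.range n) (Finset.range n)
    (fun i => kmMu a (insert p P) (V.filter (fun v => a v p = i)) ψ)
    (fun i => kmMu a (insert p P) (W.filter (fun v => a v p = i)) θ)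
    (fun i => kmMu_nonneg _ _ _ _ hψ) (fun i => kmMu_nonneg _ _ _ _ hθ)
  rw [mul_assoc]
  refine le_trans ?_ (mul_le_mul_of_nonneg_left this hK)
  simp_rw [Finset.mul_sum]
  apply Finset.sum_le_sum
  intro i _
  apply Finset.sum_le_sum
  intro j _
  exact km_step h a P p K hp hp2 hh hK IH V W ψ θ hψ hθ hV hW i j

lemma kmE_nonneg {r : ℝ} (hr : 0 ≤ r) (α β : ℕ → ℝ) (hα : ∀ i, 0 ≤ α i) (hβ : ∀ i, 0 ≤ β i)
    (i j : ℕ) : 0 ≤ kmE r α β i j :=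
  mul_nonneg (add_nonneg (kmD_nonneg _ _) (kmO_nonneg hr _ _))
    (Real.rpow_nonneg (mul_nonneg (hα _) (hβ _)) _)

lemma km_prob (h : ℕ → ℝ) (a : ℕ → ℕ → ℕ) (P : Finset ℕ) (p : ℕ) (K : ℝ) (hp : p ∉ P)
    (hp2 : 2 ≤ p) (hh : h p ≤ 1) (hK : 0 ≤ K) (IH : kmClaim h a P K) (hr : kmR p ≤ 1/768)
    (V W : Finset ℕ) (ψ θ : ℕ → ℝ) (hψ : ∀ v, 0 ≤ ψ v) (hθ : ∀ v, 0 ≤ θ v)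
    (hV : kmInj a (insert p P) V) (hW : kmInj a (insert p P) W) (F : ℝ)
    (hF : F = ∑ v ∈ V, ∑ w ∈ W, kmPhi h a (insert p P) ψ θ v w)
    (hlt : K * (kmMu a (insert p P) V ψ * kmMu a (insert p P) W θ) ^ (3/4 : ℝ) < F) :
    ∃ k, (∑ v ∈ V, ∑ w ∈ W, if a v p = k ∧ a w p = k then 0 else kmPhi h a (insert p P) ψ θ v w)
        ≤ (2 * 72 ^ 6) * kmR p ^ 4 * F ∧
      (∑ v ∈ V, ∑ w ∈ W, if a v p = k ∨ a w p = k then 0 else kmPhi h a (insert p P) ψ θ v w)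
        ≤ (2 * 72 ^ 6) * kmR p ^ 6 * F := by
  obtain ⟨n, hn1, hn2⟩ := km_exists_n a p V W
  obtain ⟨r0, r1⟩ := kmR_lt_one hp2
  have hMV := kmMu_nonneg a (insert p P) V ψ hψ
  have hMW := kmMu_nonneg a (insert p P) W θ hθ
  set MV := kmMu a (insert p P) V ψ with hMVd
  set MW := kmMu a (insert p P) W θ with hMWd
  have hm : 0 ≤ K * (MV * MW) ^ (3/4 : ℝ) := by positivity
  have hF0 : 0 < F := by linarith
  have hne : MV * MW ≠ 0 := by
    intro h0
    have := km_small h a P p K hp hp2 hh hK IH V W ψ θ hψ hθ hV hW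
    rw [← hF, ← hMVd, ← hMWd, h0, Real.zero_rpow (by norm_num)] at this
    linarith
  have hMV0 : 0 < MV := lt_of_le_of_ne hMV (fun h => hne (by rw [← h]; ring))
  have hMW0 : 0 < MW := lt_of_le_of_ne hMW (fun h => hne (by rw [← h]; ring))
  set α : ℕ → ℝ := fun i => kmMu a (insert p P) (V.filter (fun v => a v p = i)) ψ / MV with hα
  set β : ℕ → ℝ := fun i => kmMu a (insert p P) (W.filter (fun v => a v p = i)) θ / MW with hβ
  have hα0 : ∀ i, 0 ≤ α i := fun i => div_nonneg (kmMu_nonneg _ _ _ _ hψ) hMV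
  have hβ0 : ∀ i, 0 ≤ β i := fun i => div_nonneg (kmMu_nonneg _ _ _ _ hθ) hMW
  have hα1 : ∑ i ∈ Finset.range n, α i = 1 := by
    rw [hα, ← Finset.sum_div, ← km_fiber_mu a p n _ V hn1 ψ]; exact div_self hMV0.ne'
  have hβ1 : ∑ i ∈ Finset.range n, β i = 1 := by
    rw [hβ, ← Finset.sum_div, ← km_fiber_mu a p n _ W hn2 θ]; exact div_self hMW0.ne'
  have hij : ∀ i j, ∑ v ∈ V with a v p = i, ∑ w ∈ W with a w p = j,
      kmPhi h a (insert p P) ψ θ v w ≤ kmE (kmR p) α β i j * F := by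
    intro i j
    have h1 := km_step h a P p K hp hp2 hh hK IH V W ψ θ hψ hθ hV hW i j
    have e1 : kmMu a (insert p P) (V.filter (fun v => a v p = i)) ψ = MV * α i := by
      rw [hα]; field_simp
    have e2 : kmMu a (insert p P) (W.filter (fun v => a v p = j)) θ = MW * β j := by
      rw [hβ]; field_simp
    rw [e1, e2, show MV * α i * (MW * β j) = (MV * MW) * (α i * β j) by ring,
      Real.mul_rpow (by positivity) (mul_nonneg (hα0 _) (hβ0 _))] at h1
    calc _ ≤ _ := h1
      _ = kmE (kmR p) α β i j * (K * (MV * MW) ^ (3/4 : ℝ)) := by unfold kmE; ring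
      _ ≤ _ := mul_le_mul_of_nonneg_left hlt.le (kmE_nonneg r0.le α β hα0 hβ0 i j)
  have htot : 1 ≤ ∑ i ∈ Finset.range n, ∑ j ∈ Finset.range n, kmE (kmR p) α β i j := by
    have : F ≤ (∑ i ∈ Finset.range n, ∑ j ∈ Finset.range n, kmE (kmR p) α β i j) * F := by
      nth_rewrite 1 [hF]
      rw [km_fiber a p n V W hn1 hn2]
      simp_rw [Finset.sum_mul]
      exact Finset.sum_le_sum fun i _ => Finset.sum_le_sum fun j _ => hij i j
    by_contra hcon
    push Not at hcon
    nlinarith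
  have hR : ∀ R : ℕ → ℕ → Prop, ∀ [∀ i j, Decidable (R i j)], ∀ B : ℝ,
      (∑ i ∈ Finset.range n, ∑ j ∈ Finset.range n,
        if R i j then 0 else kmE (kmR p) α β i j) ≤ B →
      (∑ v ∈ V, ∑ w ∈ W, if R (a v p) (a w p) then 0 else kmPhi h a (insert p P) ψ θ v w)
        ≤ B * F := by
    intro R _ B hB
    refine le_trans ?_ (mul_le_mul_of_nonneg_right hB hF0.le)
    rw [km_fiber a p n V W hn1 hn2]
    simp_rw [Finset.sum_mul]
    apply Finset.sum_le_sum
    intro i _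
    apply Finset.sum_le_sum
    intro j _
    have : ∑ v ∈ V with a v p = i, ∑ w ∈ W with a w p = j,
        (if R (a v p) (a w p) then 0 else kmPhi h a (insert p P) ψ θ v w) =
        ∑ v ∈ V with a v p = i, ∑ w ∈ W with a w p = j,
        (if R i j then 0 else kmPhi h a (insert p P) ψ θ v w) := by
      apply Finset.sum_congr rfl
      intro v hv
      apply Finset.sum_congr rfl
      intro w hw
      rw [(Finset.mem_filter.mp hv).2, (Finset.mem_filter.mp hw).2]
    rw [this]
    split_ifs with hRij
    · simp
    · exact hij i j
  obtain ⟨k, hk1, hk2⟩ := km_key r0 hr n α β hα0 hβ0 hα1 hβ1 htot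
  refine ⟨k, ?_, ?_⟩
  · exact hR (fun i j => i = k ∧ j = k) _ hk1
  · exact hR (fun i j => i = k ∨ j = k) _ hk2

/-- N⁺ part -/
def kmPl (a : ℕ → ℕ → ℕ) (k : ℕ → ℕ) (P : Finset ℕ) (v : ℕ) : ℕ := ∏ p ∈ P, p ^ (a v p - k p)

/-- N⁻ part -/
def kmMi (a : ℕ → ℕ → ℕ) (k : ℕ → ℕ) (P : Finset ℕ) (v : ℕ) : ℕ := ∏ p ∈ P, p ^ (k p - a v p)

lemma km_fact (P : Finset ℕ) (hP : ∀ p ∈ P, p.Prime) (g : ℕ → ℕ) (q : ℕ) (hq : q ∈ P) :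
    (∏ p ∈ P, p ^ g p).factorization q = g q := by
  rw [Nat.factorization_prod (fun p hp => pow_ne_zero _ (hP p hp).ne_zero), Finset.sum_apply']
  rw [Finset.sum_eq_single q]
  · simp [(hP q hq).factorization_self]
  · intro p hp hpq
    rw [Nat.factorization_pow, Finsupp.smul_apply,
      Nat.factorization_eq_zero_of_not_dvd]
    · simp
    · intro hd
      exact hpq ((Nat.prime_dvd_prime_iff_eq (hP q hq) (hP p hp)).mp hd).symm
  · intro h; exact absurd hq h

lemma km_geomU (p k : ℕ) (hp : 2 ≤ p) :
    kmU p k * ∑ i ∈ Finset.range (k + 1), (1 / (p:ℝ)) ^ i ≤ 1 := by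
  unfold kmU
  split_ifs with h
  · simp [h]
  · rw [mul_neg_geom_sum]
    have : (0:ℝ) ≤ (1 / (p:ℝ)) ^ (k + 1) := by positivity
    linarith

lemma km_row (a : ℕ → ℕ → ℕ) (k : ℕ → ℕ) (P : Finset ℕ) (hP : ∀ p ∈ P, p.Prime) (W : Finset ℕ)
    (hW : kmInj a P W) (L c : ℝ) (hL : 0 ≤ L) (hc : 0 ≤ c)
    (h1 : ∀ w ∈ W, L * kmPl a k P w ≤ 1)
    (h2 : ∀ w ∈ W, kmRho a P w ≤ c * ∏ p ∈ P, kmU p (k p)) :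
    L * ∑ w ∈ W, kmRho a P w / kmMi a k P w ≤ c := by
  rcases hL.eq_or_lt with h0 | hL0
  · rw [← h0]; simpa using hc
  set m := ⌊1 / L⌋₊ with hm
  set RN := ∏ p ∈ P, kmU p (k p) with hRN
  have hRN0 : 0 ≤ RN := Finset.prod_nonneg fun _ _ => kmU_nonneg _ _
  have hpl : ∀ w ∈ W, kmPl a k P w ∈ Finset.Icc 1 m := by
    intro w hw
    rw [Finset.mem_Icc]
    constructor
    · exact Finset.prod_pos fun p hp => pow_pos (hP p hp).pos _
    · apply Nat.le_floor
      rw [le_div_iff₀ hL0, mul_comm]; exact h1 w hw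
  have hsum : ∑ w ∈ W, 1 / (kmMi a k P w : ℝ) ≤
      m * ∏ p ∈ P, ∑ i ∈ Finset.range (k p + 1), (1 / (p:ℝ)) ^ i := by
    rw [Finset.prod_sum]
    set T := Finset.Icc 1 m ×ˢ (P.pi fun p => Finset.range (k p + 1)) with hT
    let G : (ℕ × (∀ p ∈ P, ℕ)) → ℝ := fun x => ∏ p ∈ P.attach, (1 / (p.1:ℝ)) ^ (x.2 p.1 p.2)
    let ι : ℕ → (ℕ × (∀ p ∈ P, ℕ)) := fun w => (kmPl a k P w, fun p _ => k p - a w p)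
    have hG0 : ∀ x, 0 ≤ G x := fun x => Finset.prod_nonneg fun p _ => by positivity
    have hinj : Set.InjOn ι W := by
      intro w hw w' hw' hww
      apply hW w hw w' hw'
      intro p hp
      have e1 : kmPl a k P w = kmPl a k P w' := congrArg Prod.fst hww
      have e2 : k p - a w p = k p - a w' p :=
        congrFun (congrFun (congrArg Prod.snd hww) p) hp
      have e3 : a w p - k p = a w' p - k p := by
        rw [← km_fact P hP (fun p => a w p - k p) p hp, ← km_fact P hP (fun p => a w' p - k p) p hp]
        exact congrArg (fun n => Nat.factorization n p) e1
      omega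
    have hsub : W.image ι ⊆ T := by
      intro x hx
      obtain ⟨w, hw, rfl⟩ := Finset.mem_image.mp hx
      rw [hT, Finset.mem_product]
      refine ⟨hpl w hw, ?_⟩
      rw [Finset.mem_pi]
      intro p hp
      rw [Finset.mem_range]
      show k p - a w p < k p + 1
      omega
    calc ∑ w ∈ W, 1 / (kmMi a k P w : ℝ) = ∑ w ∈ W, G (ι w) := by
          apply Finset.sum_congr rfl
          intro w _
          show _ = ∏ p ∈ P.attach, (1 / (p.1:ℝ)) ^ (k p.1 - a w p.1)
          rw [Finset.prod_attach P (fun p => (1 / (p:ℝ)) ^ (k p - a w p))]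
          unfold kmMi
          push_cast
          rw [one_div, ← Finset.prod_inv_distrib]
          apply Finset.prod_congr rfl
          intro p _
          rw [one_div, inv_pow]
      _ = ∑ x ∈ W.image ι, G x := (Finset.sum_image hinj).symm
      _ ≤ ∑ x ∈ T, G x := Finset.sum_le_sum_of_subset_of_nonneg hsub fun x _ _ => hG0 x
      _ = _ := by
          rw [hT, Finset.sum_product]
          simp [G]
  have hprod : RN * ∏ p ∈ P, ∑ i ∈ Finset.range (k p + 1), (1 / (p:ℝ)) ^ i ≤ 1 := by
    rw [hRN, ← Finset.prod_mul_distrib]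
    apply Finset.prod_le_one
    · intro p _
      exact mul_nonneg (kmU_nonneg _ _) (Finset.sum_nonneg fun i _ => by positivity)
    · intro p hp
      exact km_geomU p (k p) (hP p hp).two_le
  have hLm : L * m ≤ 1 := by
    have : (m:ℝ) ≤ 1 / L := Nat.floor_le (by positivity)
    rw [le_div_iff₀ hL0] at this; linarith
  set Q := ∏ p ∈ P, ∑ i ∈ Finset.range (k p + 1), (1 / (p:ℝ)) ^ i with hQ
  have hQ0 : 0 ≤ Q := Finset.prod_nonneg fun p _ => Finset.sum_nonneg fun i _ => by positivity
  calc L * ∑ w ∈ W, kmRho a P w / kmMi a k P w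
      ≤ L * ∑ w ∈ W, (c * RN) * (1 / (kmMi a k P w : ℝ)) := by
        gcongr with w hw
        rw [mul_one_div]
        gcongr
        exact h2 w hw
    _ = L * ((c * RN) * ∑ w ∈ W, (1 / (kmMi a k P w : ℝ))) := by rw [← Finset.mul_sum]
    _ ≤ L * ((c * RN) * (m * Q)) := by gcongr
    _ = c * ((L * m) * (RN * Q)) := by ring
    _ ≤ c * (1 * 1) := by gcongr
    _ = c := by ring

lemma km_split (a : ℕ → ℕ → ℕ) (k : ℕ → ℕ) (P : Finset ℕ) (v w : ℕ)
    (h : ∀ p ∈ P, a v p = k p ∨ a w p = k p) :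
    kmUp a P w v = kmPl a k P w * kmMi a k P v := by
  unfold kmUp kmPl kmMi
  rw [← Finset.prod_mul_distrib]
  apply Finset.prod_congr rfl
  intro p hp
  rw [← pow_add]
  congr 1
  rcases h p hp with h | h <;> omega

open Classical in
lemma km_final (a : ℕ → ℕ → ℕ) (k : ℕ → ℕ) (P : Finset ℕ) (hP : ∀ p ∈ P, p.Prime)
    (V W : Finset ℕ) (hV : kmInj a P V) (hW : kmInj a P W) (ψ θ : ℕ → ℝ) (hψ : ∀ v, 0 ≤ ψ v)
    (hθ : ∀ v, 0 ≤ θ v) (c : ℝ) (hc : 0 ≤ c) (Q : ℕ → ℕ → Prop)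
    (hQ1 : ∀ v w, Q v w → ψ v * kmUp a P w v ≤ 1 ∧ θ w * kmUp a P v w ≤ 1)
    (hQ2 : ∀ v w, Q v w → ∀ p ∈ P, a v p = k p ∨ a w p = k p)
    (hQ3 : ∀ v w, Q v w → kmRho a P v ≤ c * ∏ p ∈ P, kmU p (k p))
    (hQ4 : ∀ v w, Q v w → kmRho a P w ≤ c * ∏ p ∈ P, kmU p (k p)) :
    (∑ v ∈ V, ∑ w ∈ W, if Q v w then (ψ v * kmRho a P v) * (θ w * kmRho a P w) else 0) ^ 2
      ≤ c ^ 2 * (kmMu a P V ψ * kmMu a P W θ) := by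
  have hMi : ∀ v, (0:ℝ) < kmMi a k P v := fun v => by
    exact_mod_cast Finset.prod_pos fun p hp => pow_pos (hP p hp).pos _
  set ρ := kmRho a P with hρ
  have hρ0 : ∀ v, 0 ≤ ρ v := kmRho_nonneg a P
  have e0 : ∀ f : ℕ → ℕ → ℝ, (∑ v ∈ V, ∑ w ∈ W, if Q v w then f v w else 0)
      = ∑ x ∈ (V ×ˢ W).filter (fun x => Q x.1 x.2), f x.1 x.2 := by
    intro f
    rw [Finset.sum_filter, Finset.sum_product]
  rw [e0 (fun v w => (ψ v * ρ v) * (θ w * ρ w))]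
  have cs := Finset.sum_sq_le_sum_mul_sum_of_sq_le_mul ((V ×ˢ W).filter (fun x => Q x.1 x.2))
    (r := fun x => (ψ x.1 * ρ x.1) * (θ x.2 * ρ x.2))
    (f := fun x => (ψ x.1 * ρ x.1) * (ψ x.1 * kmMi a k P x.1 * (ρ x.2 / kmMi a k P x.2)))
    (g := fun x => (θ x.2 * ρ x.2) * (θ x.2 * kmMi a k P x.2 * (ρ x.1 / kmMi a k P x.1)))
    (fun x _ => mul_nonneg (mul_nonneg (hψ _) (hρ0 _)) (mul_nonneg (mul_nonneg (hψ _) (hMi _).le)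
      (div_nonneg (hρ0 _) (hMi _).le)))
    (fun x _ => mul_nonneg (mul_nonneg (hθ _) (hρ0 _)) (mul_nonneg (mul_nonneg (hθ _) (hMi _).le)
      (div_nonneg (hρ0 _) (hMi _).le)))
    (fun x _ => by
      have := (hMi x.1).ne'
      have := (hMi x.2).ne'
      apply le_of_eq
      field_simp)
  refine cs.trans ?_
  rw [← e0 (fun v w => (ψ v * ρ v) * (ψ v * kmMi a k P v * (ρ w / kmMi a k P w))),
    ← e0 (fun v w => (θ w * ρ w) * (θ w * kmMi a k P w * (ρ v / kmMi a k P v)))]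
  have b1 : (∑ v ∈ V, ∑ w ∈ W, if Q v w then
      (ψ v * ρ v) * (ψ v * kmMi a k P v * (ρ w / kmMi a k P w)) else 0) ≤ c * kmMu a P V ψ := by
    unfold kmMu
    rw [Finset.mul_sum]
    apply Finset.sum_le_sum
    intro v _
    rw [← Finset.sum_filter, ← Finset.mul_sum, ← Finset.mul_sum, mul_comm c]
    apply mul_le_mul_of_nonneg_left _ (mul_nonneg (hψ _) (hρ0 _))
    apply km_row a k P hP
    · intro w hw w' hw'
      exact hW w (Finset.mem_filter.mp hw).1 w' (Finset.mem_filter.mp hw').1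
    · exact mul_nonneg (hψ _) (hMi _).le
    · exact hc
    · intro w hw
      have hq := (Finset.mem_filter.mp hw).2
      have h1 := (hQ1 v w hq).1
      rw [km_split a k P v w (hQ2 v w hq)] at h1
      push_cast at h1
      linarith
    · intro w hw
      exact hQ4 v w (Finset.mem_filter.mp hw).2
  have b2 : (∑ v ∈ V, ∑ w ∈ W, if Q v w then
      (θ w * ρ w) * (θ w * kmMi a k P w * (ρ v / kmMi a k P v)) else 0) ≤ c * kmMu a P W θ := by
    unfold kmMu
    rw [Finset.mul_sum, Finset.sum_comm]
    apply Finset.sum_le_sum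
    intro w _
    rw [← Finset.sum_filter, ← Finset.mul_sum, ← Finset.mul_sum, mul_comm c]
    apply mul_le_mul_of_nonneg_left _ (mul_nonneg (hθ _) (hρ0 _))
    apply km_row a k P hP
    · intro w hw w' hw'
      exact hV w (Finset.mem_filter.mp hw).1 w' (Finset.mem_filter.mp hw').1
    · exact mul_nonneg (hθ _) (hMi _).le
    · exact hc
    · intro v hv
      have hq := (Finset.mem_filter.mp hv).2
      have h1 := (hQ1 v w hq).2
      rw [km_split a k P w v (fun p hp => (hQ2 v w hq p hp).symm)] at h1
      push_cast at h1
      linarith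
    · intro v hv
      exact hQ3 v w (Finset.mem_filter.mp hv).2
  calc _ ≤ (c * kmMu a P V ψ) * (c * kmMu a P W θ) := by
        apply mul_le_mul b1 b2
        · apply Finset.sum_nonneg; intro v _
          apply Finset.sum_nonneg; intro w _
          split_ifs
          · exact mul_nonneg (mul_nonneg (hθ _) (hρ0 _)) (mul_nonneg (mul_nonneg (hθ _) (hMi _).le)
              (div_nonneg (hρ0 _) (hMi _).le))
          · exact le_rfl
        · exact mul_nonneg hc (kmMu_nonneg _ _ _ _ hψ)
    _ = _ := by ring

lemma kmU_bad (p i k : ℕ) (hp : 2 ≤ p) : kmU p i ≤ kmU p k * Real.exp (2 / (p:ℝ)) := by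
  have hp' : (2:ℝ) ≤ p := by exact_mod_cast hp
  have h1 : 1 - 1 / (p:ℝ) ≤ kmU p k := by
    unfold kmU; split_ifs
    · have : (0:ℝ) ≤ 1 / p := by positivity
      linarith
    · exact le_rfl
  have h2 : 2 / (p:ℝ) + 1 ≤ Real.exp (2 / (p:ℝ)) := Real.add_one_le_exp _
  have h3 : (1:ℝ) ≤ (1 - 1 / (p:ℝ)) * (2 / (p:ℝ) + 1) := by
    have hx0 : 0 ≤ 1 / (p:ℝ) := by positivity
    have hx : 1 / (p:ℝ) ≤ 1 / 2 := one_div_le_one_div_of_le (by norm_num) hp'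
    have e : 2 / (p:ℝ) = 2 * (1 / (p:ℝ)) := by ring
    rw [e]; nlinarith
  have h4 : 0 ≤ 1 - 1 / (p:ℝ) := by
    have hx : 1 / (p:ℝ) ≤ 1 / 2 := one_div_le_one_div_of_le (by norm_num) hp'
    linarith
  calc kmU p i ≤ 1 := kmU_le_one p i
    _ ≤ _ := h3
    _ ≤ _ := by gcongr; exact kmU_nonneg p k

lemma kmR_four {p : ℕ} : kmR p ^ 4 = 1 / (p:ℝ) := by
  unfold kmR
  rw [← Real.rpow_natCast, ← Real.rpow_mul (by positivity)]
  norm_num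
  rw [Real.rpow_neg_one]

lemma km_large (h : ℕ → ℝ) (a : ℕ → ℕ → ℕ) (P : Finset ℕ) (hP : ∀ p ∈ P, p.Prime)
    (hh0 : ∀ p, 0 ≤ h p) (hh1 : ∀ p, h p ≤ 1) (S0 M K : ℝ)
    (hM0 : 0 < M) (hM : M = 4 * ((2 * 72 ^ 6) * S0))
    (hS0 : ∑ p ∈ P, (2 / (p:ℝ) + h p) * (1 / (p:ℝ)) ≤ S0)
    (hR1 : ∀ p ∈ P, kmR p ≤ 1/768)
    (hR6 : ∑ p ∈ P, (2 * 72 ^ 6) * kmR p ^ 6 ≤ 1/4)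
    (hK : K = 2 * Real.exp (2 * M))
    (IH : ∀ p ∈ P, kmClaim h a (P.erase p) K) : kmClaim h a P K := by
  classical
  intro V W ψ θ hψ hθ hV hW
  by_contra hcon
  push Not at hcon
  have hK0 : 0 ≤ K := by rw [hK]; positivity
  set F := ∑ v ∈ V, ∑ w ∈ W, kmPhi h a P ψ θ v w with hF
  have hMV := kmMu_nonneg a P V ψ hψ
  have hMW := kmMu_nonneg a P W θ hθ
  set m := kmMu a P V ψ * kmMu a P W θ with hm
  have hm0 : 0 ≤ m := mul_nonneg hMV hMW
  have hF0 : 0 < F := lt_of_le_of_lt (by positivity) hcon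
  have hprob : ∀ p, ∃ k, p ∈ P →
      (∑ v ∈ V, ∑ w ∈ W, if a v p = k ∧ a w p = k then 0 else kmPhi h a P ψ θ v w)
        ≤ (2 * 72 ^ 6) * kmR p ^ 4 * F ∧
      (∑ v ∈ V, ∑ w ∈ W, if a v p = k ∨ a w p = k then 0 else kmPhi h a P ψ θ v w)
        ≤ (2 * 72 ^ 6) * kmR p ^ 6 * F := by
    intro p
    by_cases hp : p ∈ P
    · have e := Finset.insert_erase hp
      have := km_prob h a (P.erase p) p K (Finset.notMem_erase p P) (hP p hp).two_le (hh1 p) hK0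
        (IH p hp) (hR1 p hp) V W ψ θ hψ hθ (by rw [e]; exact hV) (by rw [e]; exact hW) F
        (by rw [e]) (by rw [e]; exact hcon)
      rw [e] at this
      obtain ⟨k, hk⟩ := this
      exact ⟨k, fun _ => hk⟩
    · exact ⟨0, fun h => absurd h hp⟩
  choose k hk using hprob
  have hΦ0 := kmPhi_nonneg h a P ψ θ hψ hθ
  set Φ := kmPhi h a P ψ θ with hΦ
  set S : ℕ → ℕ → ℝ := fun v w =>
    ∑ p ∈ P, if a v p = k p ∧ a w p = k p then 0 else (2 / (p:ℝ) + h p) with hS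
  have hSnn : ∀ v w, 0 ≤ S v w := fun v w => Finset.sum_nonneg fun p _ => by
    split_ifs
    · exact le_rfl
    · have := hh0 p
      positivity
  have hS1 : ∑ v ∈ V, ∑ w ∈ W, Φ v w * S v w ≤ M / 4 * F := by
    have e1 : ∑ v ∈ V, ∑ w ∈ W, Φ v w * S v w = ∑ p ∈ P, (2 / (p:ℝ) + h p) *
        (∑ v ∈ V, ∑ w ∈ W, if a v p = k p ∧ a w p = k p then 0 else Φ v w) := by
      simp_rw [hS, Finset.mul_sum]
      rw [Finset.sum_comm' (s := P) (t := fun _ => V) (t' := V) (s' := fun _ => P) (by simp [and_comm])]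
      apply Finset.sum_congr rfl
      intro v _
      rw [Finset.sum_comm]
      apply Finset.sum_congr rfl
      intro p _
      apply Finset.sum_congr rfl
      intro w _
      split_ifs <;> ring
    rw [e1]
    calc _ ≤ ∑ p ∈ P, (2 / (p:ℝ) + h p) * ((2 * 72 ^ 6) * (1 / (p:ℝ)) * F) := by
          apply Finset.sum_le_sum
          intro p hp
          have := (hk p hp).1
          rw [kmR_four] at this
          have h0 := hh0 p
          gcongr
      _ = (2 * 72 ^ 6) * F * ∑ p ∈ P, (2 / (p:ℝ) + h p) * (1 / (p:ℝ)) := by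
          rw [Finset.mul_sum]
          apply Finset.sum_congr rfl
          intro p _
          ring
      _ ≤ (2 * 72 ^ 6) * F * S0 := by gcongr
      _ = _ := by rw [hM]; ring
  have hS2 : ∑ v ∈ V, ∑ w ∈ W, ∑ p ∈ P, (if a v p = k p ∨ a w p = k p then 0 else Φ v w)
      ≤ 1 / 4 * F := by
    have e1 : ∑ v ∈ V, ∑ w ∈ W, ∑ p ∈ P, (if a v p = k p ∨ a w p = k p then 0 else Φ v w)
        = ∑ p ∈ P, ∑ v ∈ V, ∑ w ∈ W, (if a v p = k p ∨ a w p = k p then 0 else Φ v w) := by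
      rw [Finset.sum_comm (s := P)]
      apply Finset.sum_congr rfl
      intro v _
      rw [Finset.sum_comm]
    rw [e1]
    calc _ ≤ ∑ p ∈ P, (2 * 72 ^ 6) * kmR p ^ 6 * F :=
          Finset.sum_le_sum fun p hp => (hk p hp).2
      _ = (∑ p ∈ P, (2 * 72 ^ 6) * kmR p ^ 6) * F := by rw [Finset.sum_mul]
      _ ≤ _ := by gcongr
  set Q : ℕ → ℕ → Prop := fun v w =>
    (ψ v * kmUp a P w v ≤ 1 ∧ θ w * kmUp a P v w ≤ 1) ∧
    (∀ p ∈ P, a v p = k p ∨ a w p = k p) ∧ S v w ≤ M with hQ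
  set f : ℕ → ℕ → ℝ := fun v w => (ψ v * kmRho a P v) * (θ w * kmRho a P w) with hf
  have hf0 : ∀ v w, 0 ≤ f v w := fun v w => mul_nonneg (mul_nonneg (hψ _) (kmRho_nonneg _ _ _))
      (mul_nonneg (hθ _) (kmRho_nonneg _ _ _))
  have hSw : ∀ v w, kmS h a P v w ≤ Real.exp (S v w) := by
    intro v w
    rw [hS, Real.exp_sum]
    unfold kmS
    apply Finset.prod_le_prod
    · intro p _; split_ifs <;> positivity
    · intro p _
      have h0 := hh0 p
      have h2 : (0:ℝ) ≤ 2 / p := by positivity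
      split_ifs with c1 c2 c2
      · simp
      · exact Real.one_le_exp (by positivity)
      · exact absurd (c2.1.trans c2.2.symm) c1
      · apply Real.exp_le_exp.mpr; linarith
  have hRv : ∀ v w, kmRho a P v ≤ Real.exp (S v w) * ∏ p ∈ P, kmU p (k p) ∧
      kmRho a P w ≤ Real.exp (S v w) * ∏ p ∈ P, kmU p (k p) := by
    intro v w
    have gen : ∀ u, (∀ p, a v p = k p ∧ a w p = k p → a u p = k p) →
        kmRho a P u ≤ Real.exp (S v w) * ∏ p ∈ P, kmU p (k p) := by
      intro u hu
      rw [hS, Real.exp_sum, ← Finset.prod_mul_distrib]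
      unfold kmRho
      apply Finset.prod_le_prod
      · intro p _; exact kmU_nonneg _ _
      · intro p hp
        have h0 := hh0 p
        split_ifs with c1
        · rw [hu p c1]; simp
        · refine (kmU_bad p (a u p) (k p) (hP p hp).two_le).trans ?_
          rw [mul_comm]
          apply mul_le_mul_of_nonneg_right _ (kmU_nonneg _ _)
          apply Real.exp_le_exp.mpr; linarith
    exact ⟨gen v fun p hp => hp.1, gen w fun p hp => hp.2⟩
  set G := ∑ v ∈ V, ∑ w ∈ W, if Q v w then f v w else 0 with hG
  have hG0 : 0 ≤ G := Finset.sum_nonneg fun v _ => Finset.sum_nonneg fun w _ => by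
    split_ifs
    · exact hf0 v w
    · exact le_rfl
  have hpt : ∀ v w, Φ v w ≤ Real.exp M * (if Q v w then f v w else 0) + Φ v w * S v w / M
      + ∑ p ∈ P, (if a v p = k p ∨ a w p = k p then 0 else Φ v w) := by
    intro v w
    have n1 : 0 ≤ Φ v w * S v w / M := div_nonneg (mul_nonneg (hΦ0 v w) (hSnn v w)) hM0.le
    have n2 : ∀ p ∈ P, 0 ≤ (if a v p = k p ∨ a w p = k p then 0 else Φ v w) := by
      intro p _; split_ifs
      · exact le_rfl
      · exact hΦ0 v w
    have n2' := Finset.sum_nonneg n2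
    have n3 : 0 ≤ Real.exp M * (if Q v w then f v w else 0) := by
      apply mul_nonneg (Real.exp_pos _).le
      split_ifs
      · exact hf0 v w
      · exact le_rfl
    by_cases c1 : ∀ p ∈ P, a v p = k p ∨ a w p = k p
    · by_cases c2 : S v w ≤ M
      · by_cases c3 : (ψ v * kmUp a P w v ≤ 1 ∧ θ w * kmUp a P v w ≤ 1)
        · have hq : Q v w := ⟨c3, c1, c2⟩
          have : Φ v w ≤ Real.exp M * f v w := by
            have e : Φ v w = f v w * kmS h a P v w := by
              rw [hΦ, hf]; unfold kmPhi; rw [if_pos c3]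
            rw [e, mul_comm]
            apply mul_le_mul_of_nonneg_right _ (hf0 v w)
            exact (hSw v w).trans (Real.exp_le_exp.mpr c2)
          rw [if_pos hq] at n3 ⊢
          linarith
        · have e : Φ v w = 0 := by
            rw [hΦ]; unfold kmPhi; rw [if_neg c3]
          rw [e] at n1 n2' ⊢
          linarith
      · push Not at c2
        have : Φ v w ≤ Φ v w * S v w / M := by
          rw [le_div_iff₀ hM0]
          exact mul_le_mul_of_nonneg_left c2.le (hΦ0 v w)
        linarith
    · push Not at c1
      obtain ⟨p, hp, hp1, hp2⟩ := c1
      have : Φ v w ≤ ∑ p ∈ P, (if a v p = k p ∨ a w p = k p then 0 else Φ v w) := by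
        refine le_trans (le_of_eq ?_) (Finset.single_le_sum n2 hp)
        rw [if_neg]; tauto
      linarith
  have hFG : F ≤ 2 * Real.exp M * G := by
    have : F ≤ Real.exp M * G + (M / 4 * F) / M + 1 / 4 * F := by
      calc F ≤ ∑ v ∈ V, ∑ w ∈ W, (Real.exp M * (if Q v w then f v w else 0) + Φ v w * S v w / M
            + ∑ p ∈ P, (if a v p = k p ∨ a w p = k p then 0 else Φ v w)) :=
            Finset.sum_le_sum fun v _ => Finset.sum_le_sum fun w _ => hpt v w
        _ = Real.exp M * G + (∑ v ∈ V, ∑ w ∈ W, Φ v w * S v w) / M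
            + ∑ v ∈ V, ∑ w ∈ W, ∑ p ∈ P, (if a v p = k p ∨ a w p = k p then 0 else Φ v w) := by
            simp_rw [Finset.sum_add_distrib, hG, Finset.mul_sum, Finset.sum_div]
        _ ≤ _ := by gcongr
    have e : (M / 4 * F) / M = F / 4 := by field_simp
    rw [e] at this
    linarith
  have hG2 : G ^ 2 ≤ (Real.exp M) ^ 2 * m := by
    have hRN0 : 0 ≤ ∏ p ∈ P, kmU p (k p) := Finset.prod_nonneg fun _ _ => kmU_nonneg _ _
    have := km_final a k P hP V W hV hW ψ θ hψ hθ (Real.exp M) (Real.exp_pos _).le Q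
      (fun v w hq => hq.1) (fun v w hq => hq.2.1)
      (fun v w hq => (hRv v w).1.trans (mul_le_mul_of_nonneg_right
        (Real.exp_le_exp.mpr hq.2.2) hRN0))
      (fun v w hq => (hRv v w).2.trans (mul_le_mul_of_nonneg_right
        (Real.exp_le_exp.mpr hq.2.2) hRN0))
    convert this
  have hGm : G ≤ m := by
    rw [hm]; unfold kmMu
    rw [Finset.sum_mul_sum]
    apply Finset.sum_le_sum; intro v _
    apply Finset.sum_le_sum; intro w _
    split_ifs
    · exact le_rfl
    · exact hf0 v w
  have hE1 : 1 ≤ Real.exp M := Real.one_le_exp hM0.le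
  have hG4 : G ≤ Real.exp M * m ^ (3/4 : ℝ) := by
    have e : (m ^ (3/4 : ℝ)) ^ 4 = m ^ 3 := by
      rw [← Real.rpow_natCast, ← Real.rpow_mul hm0]; norm_num
    have : G ^ 4 ≤ (Real.exp M * m ^ (3/4 : ℝ)) ^ 4 := by
      rw [mul_pow, e]
      calc G ^ 4 = G ^ 2 * G ^ 2 := by ring
        _ ≤ ((Real.exp M) ^ 2 * m) * m ^ 2 := by gcongr
        _ = (Real.exp M) ^ 2 * m ^ 3 := by ring
        _ ≤ (Real.exp M) ^ 4 * m ^ 3 := by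
            gcongr
            norm_num
    exact le_of_pow_le_pow_left₀ (by norm_num) (by positivity) this
  have : F ≤ K * m ^ (3/4 : ℝ) := by
    calc F ≤ 2 * Real.exp M * G := hFG
      _ ≤ 2 * Real.exp M * (Real.exp M * m ^ (3/4 : ℝ)) := by gcongr
      _ = K * m ^ (3/4 : ℝ) := by
        rw [hK, show 2 * M = M + M by ring, Real.exp_add]; ring
  linarith

lemma kmR_mono (p T : ℕ) (hT : 1 ≤ T) (h : T ≤ p) : kmR p ≤ kmR T := by
  unfold kmR
  apply Real.rpow_le_rpow_of_nonpos
  · exact_mod_cast hT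
  · exact_mod_cast h
  · norm_num

lemma kmClaim_mono (h : ℕ → ℝ) (a : ℕ → ℕ → ℕ) (P : Finset ℕ) (K K' : ℝ) (hK : K ≤ K')
    (hP : ∀ p ∈ P, 2 ≤ p) (H : kmClaim h a P K) : kmClaim h a P K' := by
  intro V W ψ θ hψ hθ hV hW
  refine (H V W ψ θ hψ hθ hV hW).trans ?_
  apply mul_le_mul_of_nonneg_right hK
  apply Real.rpow_nonneg
  apply mul_nonneg
  · apply kmMu_nonneg <;> assumption
  · apply kmMu_nonneg <;> assumption

lemma km_T : ∃ T : ℕ, 2 ≤ T ∧ (∀ p, T ≤ p → kmR p ≤ 1/768) ∧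
    ∀ P : Finset ℕ, (∀ p ∈ P, T ≤ p) → ∑ p ∈ P, (2*72^6) * kmR p ^ 6 ≤ 1/4 := by
  have hs : Summable (fun n : ℕ => (2*72^6 : ℝ) * kmR n ^ 6) := by
    apply Summable.mul_left
    have : (fun n : ℕ => kmR n ^ 6) = fun n : ℕ => (n : ℝ) ^ (-(3/2) : ℝ) := by
      ext n
      unfold kmR
      rw [← Real.rpow_natCast, ← Real.rpow_mul (by positivity)]
      norm_num
    rw [this]
    exact Real.summable_nat_rpow.2 (by norm_num)
  have h1 := hs.vanishing (Iio_mem_nhds (show (0:ℝ) < 1/4 by norm_num))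
  obtain ⟨s, hs'⟩ := h1
  have h2 : Filter.Tendsto (fun n : ℕ => kmR n) Filter.atTop (nhds 0) :=
    (tendsto_rpow_neg_atTop (show (0:ℝ) < 1/4 by norm_num)).comp tendsto_natCast_atTop_atTop
  obtain ⟨N, hN⟩ := Filter.eventually_atTop.1 (h2.eventually (Iio_mem_nhds (show (0:ℝ) < 1/768 by norm_num)))
  refine ⟨max 2 (max N (s.sup id + 1)), le_max_left _ _, ?_, ?_⟩
  · intro p hp
    exact (hN p (by omega)).le
  · intro P hP
    refine (hs' P ?_).le
    rw [Finset.disjoint_left]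
    intro p hp hps
    have h3 := hP p hp
    have h4 : p ≤ s.sup id := Finset.le_sup (f := id) hps
    omega

lemma km_main : ∃ K : ℝ, 0 < K ∧ ∀ h : ℕ → ℝ, (∀ p, 0 ≤ h p) → (∀ p, h p ≤ 1) →
    (∀ P : Finset ℕ, ∑ p ∈ P, h p * (1 / (p:ℝ)) ≤ 2) →
    ∀ (a : ℕ → ℕ → ℕ) (P : Finset ℕ), (∀ p ∈ P, p.Prime) → kmClaim h a P K := by
  obtain ⟨T, hT2, hT1, hT6⟩ := km_T
  have hsum : Summable (fun n : ℕ => 1 / (n:ℝ) ^ 2) := Real.summable_one_div_nat_pow.2 (by norm_num)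
  set S0 : ℝ := 2 * ∑' n : ℕ, 1 / (n:ℝ) ^ 2 + 2 with hS0
  have hS0p : 0 < S0 := by
    have : 0 ≤ ∑' n : ℕ, 1 / (n:ℝ) ^ 2 := tsum_nonneg fun n => by positivity
    linarith
  set M : ℝ := 4 * ((2*72^6) * S0) with hM
  have hMp : 0 < M := by positivity
  set K0 : ℝ := 2 * Real.exp (2 * M) with hK0
  have hK0p : 0 < K0 := by positivity
  have hR2 := kmR_lt_one (p := 2) le_rfl
  set C1 : ℝ := 1 + 6 * kmR 2 / (1 - kmR 2) with hC1
  have hC1p : 1 ≤ C1 := by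
    have : 0 ≤ 6 * kmR 2 / (1 - kmR 2) := div_nonneg (by linarith [hR2.1]) (by linarith [hR2.2])
    linarith
  refine ⟨K0 * C1 ^ T, by positivity, ?_⟩
  intro h hh0 hh1 hhs a P hP
  have main : ∀ n : ℕ, ∀ P : Finset ℕ, P.card = n → (∀ p ∈ P, p.Prime) →
      kmClaim h a P (K0 * C1 ^ (P.filter (· < T)).card) := by
    intro n
    induction n with
    | zero =>
      intro P hPc hP
      have : P = ∅ := Finset.card_eq_zero.1 hPc
      subst this
      simp only [Finset.filter_empty, Finset.card_empty, pow_zero, mul_one]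
      exact km_large h a ∅ (by simp) hh0 hh1 S0 M K0 hMp hM (by simpa using hS0p.le) (by simp)
        (by norm_num) hK0 (by simp)
    | succ n ih =>
      intro P hPc hP
      by_cases hex : ∃ p ∈ P, p < T
      · obtain ⟨p, hpP, hpT⟩ := hex
        have IH := ih (P.erase p) (by rw [Finset.card_erase_of_mem hpP]; omega)
          (fun q hq => hP q (Finset.mem_of_mem_erase hq))
        have hp2 := (hP p hpP).two_le
        have h1 := km_small h a (P.erase p) p _ (Finset.notMem_erase p P) hp2 (hh1 p) (by positivity) IH
        rw [Finset.insert_erase hpP] at h1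
        refine kmClaim_mono _ _ _ _ _ ?_ (fun q hq => (hP q hq).two_le) h1
        have hc : (P.filter (· < T)).card = ((P.erase p).filter (· < T)).card + 1 := by
          rw [Finset.filter_erase, Finset.card_erase_of_mem (by simp [hpP, hpT])]
          have : 0 < (P.filter (· < T)).card := Finset.card_pos.2 ⟨p, by simp [hpP, hpT]⟩
          omega
        rw [hc, pow_succ, ← mul_assoc]
        apply mul_le_mul_of_nonneg_left _ (by positivity)
        have hR := kmR_lt_one hp2
        have hRR := kmR_mono p 2 (by norm_num) hp2
        have : 6 * kmR p / (1 - kmR p) ≤ 6 * kmR 2 / (1 - kmR 2) := by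
          apply div_le_div₀ <;> linarith [hR.1, hR.2, hR2.1, hR2.2]
        linarith
      · push Not at hex
        have hf : P.filter (· < T) = ∅ := by
          apply Finset.filter_eq_empty_iff.2
          intro x hx; simpa using hex x hx
        have hfe : ∀ p, (P.erase p).filter (· < T) = ∅ := by
          intro p
          apply Finset.filter_eq_empty_iff.2
          intro x hx; simpa using hex x (Finset.mem_of_mem_erase hx)
        rw [hf]
        simp only [Finset.card_empty, pow_zero, mul_one]
        refine km_large h a P hP hh0 hh1 S0 M K0 hMp hM ?_ (fun p hp => hT1 p (hex p hp))
          (hT6 P hex) hK0 ?_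
        · have e : ∑ p ∈ P, (2 / (p:ℝ) + h p) * (1 / (p:ℝ))
              = 2 * ∑ p ∈ P, 1 / (p:ℝ)^2 + ∑ p ∈ P, h p * (1 / (p:ℝ)) := by
            rw [Finset.mul_sum, ← Finset.sum_add_distrib]
            apply Finset.sum_congr rfl
            intro p _; ring
          rw [e]
          have := hsum.sum_le_tsum P (fun n _ => by positivity)
          linarith [hhs P]
        · intro p hp
          have IH := ih (P.erase p) (by rw [Finset.card_erase_of_mem hp]; omega)
            (fun q hq => hP q (Finset.mem_of_mem_erase hq))
          rw [hfe p] at IH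
          simpa using IH
  refine kmClaim_mono _ _ _ _ _ ?_ (fun q hq => (hP q hq).two_le) (main _ P rfl hP)
  apply mul_le_mul_of_nonneg_left _ hK0p.le
  apply pow_le_pow_right₀ hC1p
  calc _ ≤ (Finset.range T).card := Finset.card_le_card (fun x hx => by
          simp only [Finset.mem_filter] at hx; simpa using hx.2)
    _ = T := Finset.card_range T

/-- the weight -/
noncomputable def kmH (t : ℝ) (p : ℕ) : ℝ := Set.indicator {q : ℕ | t ≤ (q : ℝ)} (fun q => t / (q : ℝ)) p

lemma kmH_nonneg (t : ℝ) (ht : 1 ≤ t) (p : ℕ) : 0 ≤ kmH t p := by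
  unfold kmH
  apply Set.indicator_nonneg
  intro q _; positivity

lemma kmH_le (t : ℝ) (ht : 1 ≤ t) (p : ℕ) : kmH t p ≤ 1 := by
  unfold kmH
  by_cases h : p ∈ {q : ℕ | t ≤ (q : ℝ)}
  · rw [Set.indicator_of_mem h]
    have h' : t ≤ (p:ℝ) := h
    exact div_le_one_of_le₀ h' (by linarith)
  · rw [Set.indicator_of_notMem h]; norm_num

lemma kmH_sum (t : ℝ) (ht : 1 ≤ t) (P : Finset ℕ) : ∑ p ∈ P, kmH t p * (1 / (p:ℝ)) ≤ 2 := by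
  have hc : 1 ≤ ⌈t⌉₊ := Nat.one_le_ceil_iff.2 (by linarith)
  obtain ⟨k, hk⟩ : ∃ k, ⌈t⌉₊ = k + 1 := ⟨⌈t⌉₊ - 1, by omega⟩
  have hkt : t ≤ (k:ℝ) + 1 := by
    have := Nat.le_ceil t
    rw [hk] at this; push_cast at this; exact this
  have h1 : ∑ p ∈ P, kmH t p * (1 / (p:ℝ)) ≤
      ∑ p ∈ Finset.Ioo k (P.sup id + 1), t * ((p:ℝ)^2)⁻¹ := by
    have : ∑ p ∈ P, kmH t p * (1 / (p:ℝ)) = ∑ p ∈ P.filter (fun p : ℕ => t ≤ (p:ℝ)), t * ((p:ℝ)^2)⁻¹ := by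
      rw [Finset.sum_filter]
      apply Finset.sum_congr rfl
      intro p _
      unfold kmH
      simp only [Set.indicator, Set.mem_setOf_eq]
      split_ifs
      · rw [sq, mul_inv]; ring
      · simp
    rw [this]
    apply Finset.sum_le_sum_of_subset_of_nonneg
    · intro p hp
      simp only [Finset.mem_filter] at hp
      rw [Finset.mem_Ioo]
      have h4 : p ≤ P.sup id := Finset.le_sup (f := id) hp.1
      have h5 := Nat.ceil_le.2 hp.2
      omega
    · intro p _ _; positivity
  refine h1.trans ?_
  rw [← Finset.mul_sum]
  have h2 := sum_Ioo_inv_sq_le (α := ℝ) k (P.sup id + 1)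
  calc _ ≤ t * (2 / ((k:ℝ) + 1)) := by gcongr
    _ ≤ ((k:ℝ)+1) * (2 / ((k:ℝ) + 1)) := by gcongr
    _ = 2 := by field_simp

lemma km_prod (P : Finset ℕ) (v : ℕ) (hv : v ≠ 0) (hP : v.primeFactors ⊆ P) :
    ∏ p ∈ P, p ^ (v.factorization p) = v := by
  conv_rhs => rw [← Nat.prod_factorization_pow_eq_self hv]
  rw [Finsupp.prod]
  symm
  apply Finset.prod_subset (by simpa using hP)
  intro p _ hp
  rw [Finsupp.notMem_support_iff.1 hp, pow_zero]

lemma km_up (P : Finset ℕ) (v w : ℕ) (hv : v ≠ 0) (hw : w ≠ 0) (hP : w.primeFactors ⊆ P) :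
    (kmUp (fun n p => n.factorization p) P w v : ℝ) = (w : ℝ) / (Nat.gcd v w : ℝ) := by
  have hg : (Nat.gcd v w) ≠ 0 := Nat.gcd_ne_zero_left hv
  have hg' : (Nat.gcd v w : ℝ) ≠ 0 := by exact_mod_cast hg
  rw [eq_div_iff hg']
  have h1 := km_prod P _ hg ((Nat.primeFactors_mono (Nat.gcd_dvd_right v w) hw).trans hP)
  have h2 := km_prod P w hw hP
  have : kmUp (fun n p => n.factorization p) P w v * Nat.gcd v w = w := by
    conv_lhs => rw [← h1]
    conv_rhs => rw [← h2]
    unfold kmUp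
    rw [← Finset.prod_mul_distrib]
    apply Finset.prod_congr rfl
    intro p _
    rw [← pow_add, Nat.factorization_gcd hv hw]
    congr 1
    simp only [Finsupp.inf_apply]
    omega
  exact_mod_cast this

lemma km_rho (P : Finset ℕ) (v : ℕ) (hv : v ≠ 0) (hP : v.primeFactors ⊆ P) :
    kmRho (fun n p => n.factorization p) P v = (Nat.totient v : ℝ) / v := by
  have h := Nat.totient_eq_mul_prod_factors v
  have h' : (Nat.totient v : ℝ) = v * ∏ p ∈ v.primeFactors, (1 - (p:ℝ)⁻¹) := by
    have := congrArg (fun x : ℚ => (x : ℝ)) h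
    push_cast at this
    exact this
  have hv' : (v:ℝ) ≠ 0 := by exact_mod_cast hv
  rw [h', mul_div_cancel_left₀ _ hv']
  unfold kmRho
  symm
  have : ∏ p ∈ v.primeFactors, (1 - (p:ℝ)⁻¹) = ∏ p ∈ v.primeFactors, kmU p (v.factorization p) := by
    apply Finset.prod_congr rfl
    intro p hp
    have : v.factorization p ≠ 0 := by
      rw [← Nat.support_factorization] at hp
      exact Finsupp.mem_support_iff.1 hp
    simp [kmU, this]
  rw [this]
  apply Finset.prod_subset hP
  intro p _ hp
  rw [← Nat.support_factorization] at hp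
  have := Finsupp.notMem_support_iff.1 hp
  simp [kmU, this]

lemma km_ne (v w p : ℕ) (hv : v ≠ 0) (hw : w ≠ 0)
    (hp : p ∈ (v * w / Nat.gcd v w ^ 2).primeFactors) :
    v.factorization p ≠ w.factorization p ∧ (p ∣ v ∨ p ∣ w) ∧ p.Prime := by
  have hd : Nat.gcd v w ^ 2 ∣ v * w := by
    rw [sq]; exact Nat.mul_dvd_mul (Nat.gcd_dvd_left _ _) (Nat.gcd_dvd_right _ _)
  have hpp := Nat.prime_of_mem_primeFactors hp
  have hdv := Nat.dvd_of_mem_primeFactors hp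
  refine ⟨?_, (Nat.Prime.dvd_mul hpp).1 (hdv.trans (Nat.div_dvd_of_dvd hd)), hpp⟩
  intro he
  rw [← Nat.support_factorization] at hp
  apply Finsupp.mem_support_iff.1 hp
  rw [Nat.factorization_div hd, Nat.factorization_mul hv hw, Nat.factorization_pow,
    Nat.factorization_gcd hv hw]
  simp only [Finsupp.tsub_apply, Finsupp.add_apply, Finsupp.smul_apply, Finsupp.inf_apply, smul_eq_mul]
  rw [he]; simp; omega

lemma km_Sge (t : ℝ) (ht : 1 ≤ t) (P : Finset ℕ) (v w : ℕ) (hv : v ≠ 0) (hw : w ≠ 0)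
    (hPv : v.primeFactors ⊆ P) (hPw : w.primeFactors ⊆ P)
    (hs : 10 ≤ primeSum t (v * w / Nat.gcd v w ^ 2)) :
    Real.exp (10 * t) ≤ kmS (kmH t) (fun n p => n.factorization p) P v w := by
  have h1 : kmS (kmH t) (fun n p => n.factorization p) P v w =
      Real.exp (∑ p ∈ P, if v.factorization p = w.factorization p then 0 else kmH t p) := by
    rw [Real.exp_sum]
    unfold kmS
    apply Finset.prod_congr rfl
    intro p _
    split_ifs <;> simp
  rw [h1]
  apply Real.exp_le_exp.2
  have h2 : t * primeSum t (v * w / Nat.gcd v w ^ 2) ≤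
      ∑ p ∈ P, if v.factorization p = w.factorization p then 0 else kmH t p := by
    unfold primeSum
    rw [Finset.mul_sum]
    calc _ = ∑ p ∈ (v * w / Nat.gcd v w ^ 2).primeFactors,
            if v.factorization p = w.factorization p then 0 else kmH t p := by
          apply Finset.sum_congr rfl
          intro p hp
          rw [if_neg (km_ne v w p hv hw hp).1]
          unfold kmH
          simp only [Set.indicator]
          split_ifs <;> ring
      _ ≤ _ := by
          apply Finset.sum_le_sum_of_subset_of_nonneg
          · intro p hp
            obtain ⟨_, h | h, hpp⟩ := km_ne v w p hv hw hp
            · exact hPv (Nat.mem_primeFactors.2 ⟨hpp, h, hv⟩)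
            · exact hPw (Nat.mem_primeFactors.2 ⟨hpp, h, hw⟩)
          · intro p _ _
            split_ifs
            · exact le_rfl
            · exact kmH_nonneg t ht p
  nlinarith

/-- **Koukoulopoulos–Maynard, Proposition 5.4**: if `Y ≥ X ≥ 1` and
`ψ : ℤ ∩ [X,Y] → [0,∞)` with `1 ≤ ∑_{X ≤ n ≤ Y} ψ(n)φ(n)/n ≤ 2`, then for `t ≥ 1`,
`∑_{(v,w) ∈ ℰ_t} (ψ(v)φ(v)/v)(ψ(w)φ(w)/w) ≪ 1/t`, where
`ℰ_t = {(v,w) : D(v,w) ≤ t, ∑_{p | vw/gcd(v,w)², p ≥ t} 1/p ≥ 10}`. -/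
theorem KM_prop_5_4 :
    ∃ K : ℝ, 0 < K ∧ ∀ (X Y : ℝ) (ψ : ℕ → ℝ) (t : ℝ),
      1 ≤ X → X ≤ Y → (∀ n, 0 ≤ ψ n) →
      1 ≤ ∑ n ∈ Finset.Icc ⌈X⌉₊ ⌊Y⌋₊, ψ n * (Nat.totient n : ℝ) / n →
      (∑ n ∈ Finset.Icc ⌈X⌉₊ ⌊Y⌋₊, ψ n * (Nat.totient n : ℝ) / n) ≤ 2 →
      1 ≤ t →
      ∑ vw ∈ Finset.Icc ⌈X⌉₊ ⌊Y⌋₊ ×ˢ Finset.Icc ⌈X⌉₊ ⌊Y⌋₊,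
        Set.indicator
          {q : ℕ × ℕ | Dfun ψ q.1 q.2 ≤ t ∧
            10 ≤ primeSum t (q.1 * q.2 / Nat.gcd q.1 q.2 ^ 2)}
          (fun q => (ψ q.1 * (Nat.totient q.1 : ℝ) / q.1) *
            (ψ q.2 * (Nat.totient q.2 : ℝ) / q.2)) vw
        ≤ K / t := by
  obtain ⟨K, hK, hmain⟩ := km_main
  refine ⟨4 * K, by positivity, ?_⟩
  intro X Y ψ t hX hXY hψ _ hs2 ht
  have ht0 : 0 < t := by linarith
  set V := Finset.Icc ⌈X⌉₊ ⌊Y⌋₊ with hV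
  set P := (Finset.range (⌊Y⌋₊ + 1)).filter Nat.Prime with hP
  have hV0 : ∀ v ∈ V, v ≠ 0 := by
    intro v hv
    have h1 : 1 ≤ ⌈X⌉₊ := Nat.one_le_ceil_iff.2 (by linarith)
    have := (Finset.mem_Icc.1 hv).1
    omega
  have hVP : ∀ v ∈ V, v.primeFactors ⊆ P := by
    intro v hv p hp
    have h1 := (Finset.mem_Icc.1 hv).2
    have h2 := Nat.le_of_mem_primeFactors hp
    simp only [hP, Finset.mem_filter, Finset.mem_range]
    exact ⟨by omega, Nat.prime_of_mem_primeFactors hp⟩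
  set a : ℕ → ℕ → ℕ := fun n p => n.factorization p with ha
  have hinj : kmInj a P V := by
    intro v hv w hw h
    rw [← km_prod P v (hV0 v hv) (hVP v hv), ← km_prod P w (hV0 w hw) (hVP w hw)]
    apply Finset.prod_congr rfl
    intro p hp
    rw [show v.factorization p = w.factorization p from h p hp]
  set θ : ℕ → ℝ := fun n => ψ n / t with hθ
  have hθ0 : ∀ n, 0 ≤ θ n := fun n => div_nonneg (hψ n) ht0.le
  have hc := hmain (kmH t) (kmH_nonneg t ht) (kmH_le t ht) (kmH_sum t ht) a P
    (fun p hp => (Finset.mem_filter.1 hp).2) V V θ θ hθ0 hθ0 hinj hinj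
  have hmu : kmMu a P V θ ≤ 2 := by
    have : kmMu a P V θ = (∑ n ∈ V, ψ n * (Nat.totient n : ℝ) / n) / t := by
      unfold kmMu
      rw [Finset.sum_div]
      apply Finset.sum_congr rfl
      intro v hv
      rw [km_rho P v (hV0 v hv) (hVP v hv)]
      simp only [hθ]; ring
    rw [this, div_le_iff₀ ht0]
    nlinarith
  have hmu0 := kmMu_nonneg a P V θ hθ0
  have hrp : (kmMu a P V θ * kmMu a P V θ) ^ (3/4:ℝ) ≤ 4 := by
    calc _ ≤ (4:ℝ) ^ (3/4:ℝ) := by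
          apply Real.rpow_le_rpow (by positivity) _ (by norm_num)
          nlinarith
      _ ≤ (4:ℝ) ^ (1:ℝ) := Real.rpow_le_rpow_of_exponent_le (by norm_num) (by norm_num)
      _ = 4 := by norm_num
  have hc2 : ∑ v ∈ V, ∑ w ∈ V, kmPhi (kmH t) a P θ θ v w ≤ 4 * K := by nlinarith
  have hexp : t ^ 3 ≤ Real.exp (10 * t) := by
    have h1 : t ≤ Real.exp t := by linarith [Real.add_one_le_exp t]
    calc t ^ 3 ≤ (Real.exp t) ^ 3 := by gcongr
      _ = Real.exp (3 * t) := by rw [← Real.exp_nat_mul]; norm_num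
      _ ≤ Real.exp (10 * t) := Real.exp_le_exp.2 (by linarith)
  rw [le_div_iff₀ ht0]
  refine le_trans ?_ hc2
  rw [Finset.sum_product, Finset.sum_mul]
  apply Finset.sum_le_sum
  intro v hv
  rw [Finset.sum_mul]
  apply Finset.sum_le_sum
  intro w hw
  have hv0 := hV0 v hv
  have hw0 := hV0 w hw
  have hg : (0:ℝ) < (Nat.gcd v w : ℝ) := by exact_mod_cast Nat.gcd_pos_of_pos_left w (Nat.pos_of_ne_zero hv0)
  by_cases hm : (v, w) ∈ {q : ℕ × ℕ | Dfun ψ q.1 q.2 ≤ t ∧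
            10 ≤ primeSum t (q.1 * q.2 / Nat.gcd q.1 q.2 ^ 2)}
  · rw [Set.indicator_of_mem hm]
    obtain ⟨hD, hS⟩ := hm
    simp only at hD hS ⊢
    unfold Dfun at hD
    rw [div_le_iff₀ hg] at hD
    have hD1 := (le_max_left _ _).trans hD
    have hD2 := (le_max_right _ _).trans hD
    have c1 : θ v * (kmUp a P w v : ℝ) ≤ 1 := by
      rw [km_up P v w hv0 hw0 (hVP w hw)]
      simp only [hθ]
      rw [div_mul_div_comm, div_le_one (by positivity)]
      linarith
    have c2 : θ w * (kmUp a P v w : ℝ) ≤ 1 := by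
      rw [km_up P w v hw0 hv0 (hVP v hv), Nat.gcd_comm w v]
      simp only [hθ]
      rw [div_mul_div_comm, div_le_one (by positivity)]
      linarith
    unfold kmPhi
    rw [if_pos ⟨c1, c2⟩, km_rho P v hv0 (hVP v hv), km_rho P w hw0 (hVP w hw)]
    have h1 := km_Sge t ht P v w hv0 hw0 (hVP v hv) (hVP w hw) hS
    set A := (ψ v * (Nat.totient v : ℝ) / v) * (ψ w * (Nat.totient w : ℝ) / w) with hA
    have hA0 : 0 ≤ A := by
      have := hψ v
      have := hψ w
      positivity
    have e : θ v * ((Nat.totient v : ℝ) / v) * (θ w * ((Nat.totient w : ℝ) / w)) = A / t ^ 2 := by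
      simp only [hθ, hA]; field_simp
    rw [e]
    calc A * t = A / t ^ 2 * t ^ 3 := by field_simp
      _ ≤ _ := by
        apply mul_le_mul_of_nonneg_left (hexp.trans h1) (by positivity)
  · rw [Set.indicator_of_notMem hm, zero_mul]
    exact kmPhi_nonneg _ _ _ _ _ hθ0 hθ0 v w
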